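/- arXiv:1404.0890 — 2 statements merged into one kernel-verified Lean document; each statement's English description precedes it below -/
import Mathlib

section
/- (Euler-type expansion for the approximate flow of a rough differential equation.) Let E be a Banach space, V a C²_b vector field and V₁,…,V_ℓ C³_b vector fields on E, and let (X,𝕏) be a weak geometric Hölder p-rough path over ℝ^ℓ on [0,T], 2≤p<3. For (s,t)∈Δ_T let μ_{ts} : E → E be the time-1 map of the ODE ẏ_u = (t−s)V(y_u) + X^i_{ts}V_i(y_u) + ½ 𝕏^{jk}_{ts}[V_j,V_k](y_u) (sum over repeated indices, 0≤u≤1). Then there exists a constant c>0, depending only on V and the V_i (not on X, s, t), such that for every bounded C³ function f : E → ℝ with bounded derivatives and every (s,t)∈Δ_T, ‖f∘μ_{ts} − (f + (t−s)Vf + X^i_{ts}(V_if) + 𝕏^{jk}_{ts}(V_jV_kf))‖_∞ ≤ c(1+‖X‖³)‖f‖_{C³}|t−s|^{3/p}. -/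
/-!
Statement 13: Euler-type expansion for the approximate flow of a rough differential
equation (proposition 4.2 / PropEstimatesRDEWarmUp).
-/

noncomputable section

variable {E : Type*} [NormedAddCommGroup E] [NormedSpace ℝ E] [CompleteSpace E]

/-- A vector field (or function) is `C^k_b` if it is `C^k`, bounded, with bounded
derivatives up to order `k`. -/
def CkbMap (k : ℕ) {F : Type*} [NormedAddCommGroup F] [NormedSpace ℝ F]
    (W : E → F) : Prop :=
  ContDiff ℝ k W ∧ ∀ i ≤ k, ∃ M : ℝ, ∀ x : E, ‖iteratedFDeriv ℝ i W x‖ ≤ M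

/-- The Lie bracket `[V_j, V_k] = DV_k (V_j) - DV_j (V_k)` of two vector fields. -/
def bracket (Vj Vk : E → E) : E → E :=
  fun y => fderiv ℝ Vk y (Vj y) - fderiv ℝ Vj y (Vk y)

/-- The driving vector field
`y ↦ (t-s) V(y) + X^i_{ts} V_i(y) + ½ 𝕏^{jk}_{ts} [V_j, V_k](y)` of the ODE whose
time-1 map defines `μ_{ts}`. -/
def rdeDriver (ℓ : ℕ) (V : E → E) (Vf : Fin ℓ → E → E)
    (Xts : EuclideanSpace ℝ (Fin ℓ)) (XXts : EuclideanSpace ℝ (Fin ℓ × Fin ℓ))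
    (Δ : ℝ) : E → E :=
  fun y => Δ • V y + (∑ i : Fin ℓ, Xts i • Vf i y) +
    (2⁻¹ : ℝ) • ∑ j : Fin ℓ, ∑ k : Fin ℓ, XXts (j, k) • bracket (Vf j) (Vf k) y

/-- `‖f‖_{C³}`: the sum of the supremum norms of `f` and its first three derivatives. -/
def C3norm (f : E → ℝ) : ℝ :=
  ∑ i ∈ Finset.range 4, ⨆ x : E, ‖iteratedFDeriv ℝ i f x‖

section LieDerivative

variable {F G : Type*} [NormedAddCommGroup F] [NormedSpace ℝ F]
  [NormedAddCommGroup G] [NormedSpace ℝ G]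

/-- `φ` is of class `C^n` and its derivatives up to order `n` are bounded by `M`. -/
def CkBoundedBy (n : ℕ) (M : ℝ) (φ : F → G) : Prop :=
  ContDiff ℝ n φ ∧ ∀ i ≤ n, ∀ x, ‖iteratedFDeriv ℝ i φ x‖ ≤ M

/-- The derivative of the function `f` along the vector field `W`. -/
def lieDeriv (W : F → F) (f : F → ℝ) : F → ℝ := fun y => fderiv ℝ f y (W y)

namespace CkBoundedBy

variable {n m : ℕ} {M N : ℝ} {φ : F → G}

theorem mono (h : CkBoundedBy n M φ) (hm : m ≤ n) (hM : M ≤ N) : CkBoundedBy m N φ :=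
  ⟨h.1.of_le (by exact_mod_cast hm), fun i hi x => (h.2 i (hi.trans hm) x).trans hM⟩

theorem norm_le (h : CkBoundedBy n M φ) (x : F) : ‖φ x‖ ≤ M := by
  simpa using h.2 0 (Nat.zero_le n) x

theorem bound_nonneg (h : CkBoundedBy n M φ) : 0 ≤ M :=
  (norm_nonneg _).trans (h.norm_le 0)

theorem norm_fderiv_le (h : CkBoundedBy n M φ) (hn : 1 ≤ n) (x : F) : ‖fderiv ℝ φ x‖ ≤ M := by
  rw [← norm_iteratedFDeriv_one]
  exact h.2 1 hn x

theorem differentiable (h : CkBoundedBy n M φ) (hn : 1 ≤ n) : Differentiable ℝ φ :=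
  h.1.differentiable (by exact_mod_cast (by omega : n ≠ 0))

theorem lieDeriv {W : F → F} {f : F → ℝ} (hf : CkBoundedBy (n + 1) N f)
    (hW : CkBoundedBy n M W) : CkBoundedBy n (2 ^ n * N * M) (lieDeriv W f) := by
  have hf' : ContDiff ℝ n (fderiv ℝ f) := hf.1.fderiv_right (by norm_cast)
  refine ⟨hf'.clm_apply hW.1, fun i hi x => ?_⟩
  have hN := hf.bound_nonneg
  have hM := hW.bound_nonneg
  calc ‖iteratedFDeriv ℝ i (fun y => fderiv ℝ f y (W y)) x‖
      ≤ ∑ k ∈ Finset.range (i + 1), (i.choose k : ℝ) * ‖iteratedFDeriv ℝ k (fderiv ℝ f) x‖ *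
          ‖iteratedFDeriv ℝ (i - k) W x‖ :=
        norm_iteratedFDeriv_clm_apply hf' hW.1 x (by exact_mod_cast hi)
    _ ≤ ∑ k ∈ Finset.range (i + 1), (i.choose k : ℝ) * N * M := by
        refine Finset.sum_le_sum fun k hk => ?_
        have hk : k ≤ i := Nat.lt_succ_iff.1 (Finset.mem_range.1 hk)
        have h1 : ‖iteratedFDeriv ℝ k (fderiv ℝ f) x‖ ≤ N := by
          rw [norm_iteratedFDeriv_fderiv]
          exact hf.2 _ (by omega) x
        gcongr
        exact hW.2 _ (by omega) x
    _ = 2 ^ i * N * M := by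
        rw [← Finset.sum_mul, ← Finset.sum_mul]
        congr 2
        exact_mod_cast Nat.sum_range_choose i
    _ ≤ 2 ^ n * N * M := by
        gcongr
        norm_num

theorem abs_lieDeriv_le {W : F → F} {f : F → ℝ} {R : ℝ} (hf : CkBoundedBy n N f) (hn : 1 ≤ n)
    (hW : ∀ x, ‖W x‖ ≤ R) (x : F) : |_root_.lieDeriv W f x| ≤ N * R :=
  ((fderiv ℝ f x).le_opNorm (W x)).trans
    (mul_le_mul (hf.norm_fderiv_le hn x) (hW x) (norm_nonneg _) hf.bound_nonneg)

end CkBoundedBy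

theorem CkbMap.exists_ckBoundedBy {k : ℕ} {W : F → G} (hW : CkbMap k W) : ∃ M, CkBoundedBy k M W := by
  obtain ⟨hc, hb⟩ := hW
  choose! M hM using hb
  refine ⟨∑ i ∈ Finset.range (k + 1), M i, hc, fun i hi x => (hM i hi x).trans ?_⟩
  refine Finset.single_le_sum (f := M) (fun j hj => ?_) (Finset.mem_range.2 (by omega))
  exact (norm_nonneg _).trans (hM j (Nat.lt_succ_iff.1 (Finset.mem_range.1 hj)) 0)

theorem CkbMap.ckBoundedBy_C3norm {f : F → ℝ} (hf : CkbMap 3 f) : CkBoundedBy 3 (C3norm f) f := by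
  refine ⟨hf.1, fun i hi x => ?_⟩
  obtain ⟨M, hM⟩ := hf.2 i hi
  have hbdd : BddAbove (Set.range fun x => ‖iteratedFDeriv ℝ i f x‖) :=
    ⟨M, by rintro _ ⟨x, rfl⟩; exact hM x⟩
  refine (le_ciSup hbdd x).trans ?_
  exact Finset.single_le_sum (f := fun i => ⨆ x : F, ‖iteratedFDeriv ℝ i f x‖)
    (fun j _ => Real.iSup_nonneg fun x => norm_nonneg _) (Finset.mem_range.2 (by omega))

end LieDerivative

section Driver

variable {F : Type*} [NormedAddCommGroup F] [NormedSpace ℝ F]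
variable {ℓ : ℕ} {V : F → F} {Vf : Fin ℓ → F → F} {M N : ℝ}
  (a : EuclideanSpace ℝ (Fin ℓ)) (A : EuclideanSpace ℝ (Fin ℓ × Fin ℓ)) {Δ : ℝ}

theorem lieDeriv_rdeDriver (f : F → ℝ) (x : F) :
    lieDeriv (rdeDriver ℓ V Vf a A Δ) f x = Δ * lieDeriv V f x +
      ∑ i, a i * lieDeriv (Vf i) f x +
      2⁻¹ * ∑ j, ∑ k, A (j, k) * lieDeriv (bracket (Vf j) (Vf k)) f x := by
  simp only [lieDeriv, rdeDriver, map_add, map_smul, map_sum, smul_eq_mul]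

theorem lieDeriv_bracket {W₁ W₂ : F → F} {f : F → ℝ} (hf : ContDiff ℝ 2 f)
    (h₁ : Differentiable ℝ W₁) (h₂ : Differentiable ℝ W₂) (x : F) :
    lieDeriv (bracket W₁ W₂) f x =
      lieDeriv W₁ (lieDeriv W₂ f) x - lieDeriv W₂ (lieDeriv W₁ f) x := by
  have hf' : Differentiable ℝ (fderiv ℝ f) :=
    (hf.fderiv_right (m := 1) (by norm_num)).differentiable (by norm_num)
  have key (W : F → F) (hW : Differentiable ℝ W) (v : F) :
      fderiv ℝ (lieDeriv W f) x v =
        fderiv ℝ f x (fderiv ℝ W x v) + fderiv ℝ (fderiv ℝ f) x v (W x) := by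
    have := (hf' x).hasFDerivAt.clm_apply (hW x).hasFDerivAt
    rw [show lieDeriv W f = fun y => fderiv ℝ f y (W y) from rfl, this.fderiv]
    simp
  have hsymm : fderiv ℝ (fderiv ℝ f) x (W₁ x) (W₂ x) = fderiv ℝ (fderiv ℝ f) x (W₂ x) (W₁ x) :=
    (hf.contDiffAt.isSymmSndFDerivAt (by simp)).eq _ _
  change fderiv ℝ f x (bracket W₁ W₂ x) =
    fderiv ℝ (lieDeriv W₂ f) x (W₁ x) - fderiv ℝ (lieDeriv W₁ f) x (W₂ x)
  rw [key _ h₂, key _ h₁, bracket, map_sub, hsymm]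
  ring

theorem norm_bracket_le {W₁ W₂ : F → F} {n : ℕ} (hn : 1 ≤ n) (h₁ : CkBoundedBy n M W₁)
    (h₂ : CkBoundedBy n M W₂) (x : F) : ‖bracket W₁ W₂ x‖ ≤ 2 * M ^ 2 := by
  have hM := h₁.bound_nonneg
  have e₁ : ‖fderiv ℝ W₂ x (W₁ x)‖ ≤ M * M :=
    ((fderiv ℝ W₂ x).le_opNorm _).trans
      (mul_le_mul (h₂.norm_fderiv_le hn x) (h₁.norm_le x) (norm_nonneg _) hM)
  have e₂ : ‖fderiv ℝ W₁ x (W₂ x)‖ ≤ M * M :=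
    ((fderiv ℝ W₁ x).le_opNorm _).trans
      (mul_le_mul (h₁.norm_fderiv_le hn x) (h₂.norm_le x) (norm_nonneg _) hM)
  calc ‖bracket W₁ W₂ x‖ ≤ M * M + M * M := (norm_sub_le _ _).trans (add_le_add e₁ e₂)
    _ = 2 * M ^ 2 := by ring

theorem norm_rdeDriver_le (hM : 1 ≤ M) (hΔ : 0 ≤ Δ) (hV : CkBoundedBy 2 M V)
    (hVf : ∀ i, CkBoundedBy 3 M (Vf i)) (x : F) :
    ‖rdeDriver ℓ V Vf a A Δ x‖ ≤ M ^ 2 * (Δ + ∑ i, |a i| + ∑ j, ∑ k, |A (j, k)|) := by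
  have hM2 : M ≤ M ^ 2 := by nlinarith
  have e₁ : ‖Δ • V x‖ ≤ Δ * M ^ 2 := by
    rw [norm_smul, Real.norm_of_nonneg hΔ]
    gcongr
    exact (hV.norm_le x).trans hM2
  have e₂ : ‖∑ i, a i • Vf i x‖ ≤ (∑ i, |a i|) * M ^ 2 := by
    rw [Finset.sum_mul]
    refine norm_sum_le_of_le _ fun i _ => ?_
    rw [norm_smul, Real.norm_eq_abs]
    gcongr
    exact ((hVf i).norm_le x).trans hM2
  have e₃ : ‖∑ j, ∑ k, A (j, k) • bracket (Vf j) (Vf k) x‖ ≤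
      (∑ j, ∑ k, |A (j, k)|) * (2 * M ^ 2) := by
    simp_rw [Finset.sum_mul]
    refine norm_sum_le_of_le _ fun j _ => norm_sum_le_of_le _ fun k _ => ?_
    rw [norm_smul, Real.norm_eq_abs]
    gcongr
    exact norm_bracket_le (by norm_num) (hVf j) (hVf k) x
  calc ‖rdeDriver ℓ V Vf a A Δ x‖
      ≤ ‖Δ • V x‖ + ‖∑ i, a i • Vf i x‖ +
        ‖(2⁻¹ : ℝ) • ∑ j, ∑ k, A (j, k) • bracket (Vf j) (Vf k) x‖ := norm_add₃_le
    _ ≤ Δ * M ^ 2 + (∑ i, |a i|) * M ^ 2 + 2⁻¹ * ((∑ j, ∑ k, |A (j, k)|) * (2 * M ^ 2)) := by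
        rw [norm_smul (2⁻¹ : ℝ), Real.norm_of_nonneg (by norm_num : (0 : ℝ) ≤ 2⁻¹)]
        gcongr
    _ = _ := by ring

end Driver

section Flow

variable {F : Type*} [NormedAddCommGroup F] [NormedSpace ℝ F] {G : F → F} {y : ℝ → F}

theorem hasDerivAt_comp_flow {φ : F → ℝ} (hφ : Differentiable ℝ φ) {u : ℝ}
    (hy : HasDerivAt y (G (y u)) u) :
    HasDerivAt (fun r => φ (y r)) (lieDeriv G φ (y u)) u :=
  (hφ (y u)).hasFDerivAt.comp_hasDerivAt u hy

/-- If a function of the flow has generator `ε`-close to the constant `b`, then its increment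
is `ε`-close to linear. -/
theorem abs_comp_flow_sub_le {φ : F → ℝ} (hφ : Differentiable ℝ φ)
    (hy : ∀ u ∈ Set.Icc (0 : ℝ) 1, HasDerivAt y (G (y u)) u) {b ε : ℝ}
    (hb : ∀ u ∈ Set.Icc (0 : ℝ) 1, |lieDeriv G φ (y u) - b| ≤ ε)
    {u : ℝ} (hu : u ∈ Set.Icc (0 : ℝ) 1) : |φ (y u) - φ (y 0) - u * b| ≤ ε := by
  have hd : ∀ r ∈ Set.Icc (0 : ℝ) 1, HasDerivWithinAt (fun r => φ (y r) - r * b)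
      (lieDeriv G φ (y r) - b) (Set.Icc 0 1) r := fun r hr =>
    ((hasDerivAt_comp_flow hφ (hy r hr)).sub
      ((hasDerivAt_id r).mul_const b)).hasDerivWithinAt.congr_deriv (by rw [one_mul])
  have h := norm_image_sub_le_of_norm_deriv_le_segment' hd
    (fun r hr => hb r (Set.Ico_subset_Icc_self hr)) u hu
  have hε : 0 ≤ ε := (abs_nonneg _).trans (hb u hu)
  rw [Real.norm_eq_abs] at h
  calc |φ (y u) - φ (y 0) - u * b| = |φ (y u) - u * b - (φ (y 0) - 0 * b)| := by ring_nf
    _ ≤ ε * (u - 0) := h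
    _ ≤ ε := by nlinarith [hu.2]

theorem CkBoundedBy.abs_comp_flow_sub_le {n : ℕ} {N R : ℝ} {φ : F → ℝ}
    (hφ : CkBoundedBy n N φ) (hn : 1 ≤ n)
    (hy : ∀ u ∈ Set.Icc (0 : ℝ) 1, HasDerivAt y (G (y u)) u) (hG : ∀ x, ‖G x‖ ≤ R)
    {u : ℝ} (hu : u ∈ Set.Icc (0 : ℝ) 1) : |φ (y u) - φ (y 0)| ≤ N * R := by
  simpa using _root_.abs_comp_flow_sub_le (hφ.differentiable hn) hy (b := 0)
    (fun r _ => by simpa using hφ.abs_lieDeriv_le hn hG (y r)) hu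

/-- A scalar function with derivative `ε`-close to `a + u b` on `[0,1]` has increment
`ε`-close to `a + b / 2`. -/
theorem abs_sub_sub_le_of_hasDerivAt {g g' : ℝ → ℝ} {a b ε : ℝ}
    (hg : ∀ u ∈ Set.Icc (0 : ℝ) 1, HasDerivAt g (g' u) u)
    (hb : ∀ u ∈ Set.Icc (0 : ℝ) 1, |g' u - (a + u * b)| ≤ ε) :
    |g 1 - g 0 - (a + 2⁻¹ * b)| ≤ ε := by
  have hd : ∀ r ∈ Set.Icc (0 : ℝ) 1, HasDerivWithinAt (fun r => g r - (r * a + r ^ 2 * (2⁻¹ * b)))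
      (g' r - (a + r * b)) (Set.Icc 0 1) r := fun r hr => by
    refine ((hg r hr).sub (((hasDerivAt_id r).mul_const a).add
      ((hasDerivAt_pow 2 r).mul_const (2⁻¹ * b)))).hasDerivWithinAt.congr_deriv ?_
    simp only [Nat.cast_ofNat, Nat.add_one_sub_one, pow_one]
    ring
  have h := norm_image_sub_le_of_norm_deriv_le_segment_01' hd
    (fun r hr => hb r (Set.Ico_subset_Icc_self hr))
  rw [Real.norm_eq_abs] at h
  calc |g 1 - g 0 - (a + 2⁻¹ * b)|
      = |g 1 - (1 * a + 1 ^ 2 * (2⁻¹ * b)) - (g 0 - (0 * a + 0 ^ 2 * (2⁻¹ * b)))| := by ring_nf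
    _ ≤ ε := h

end Flow

theorem abs_sum_mul_le {ι : Type*} [Fintype ι] (a r : ι → ℝ) {ε : ℝ} (h : ∀ i, |r i| ≤ ε) :
    |∑ i, a i * r i| ≤ (∑ i, |a i|) * ε := by
  rw [Finset.sum_mul]
  refine (Finset.abs_sum_le_sum_abs _ _).trans (Finset.sum_le_sum fun i _ => ?_)
  rw [abs_mul]
  gcongr
  exact h i

theorem abs_sum_sum_mul_le {ι κ : Type*} [Fintype ι] [Fintype κ] (a r : ι → κ → ℝ) {ε : ℝ}
    (h : ∀ i j, |r i j| ≤ ε) :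
    |∑ i, ∑ j, a i j * r i j| ≤ (∑ i, ∑ j, |a i j|) * ε := by
  rw [Finset.sum_mul]
  exact (Finset.abs_sum_le_sum_abs _ _).trans
    (Finset.sum_le_sum fun i _ => abs_sum_mul_le _ _ (h i))

/-- The second order part of the expansion is `∑ 𝕏^{jk} V_j V_k f` once the symmetric part of
`A` is `½ a ⊗ a`. -/
theorem sum_antisymm_add_sum_symm {ℓ : ℕ} (a : Fin ℓ → ℝ) (A L : Fin ℓ → Fin ℓ → ℝ)
    (hA : ∀ j k, A j k + A k j = a j * a k) :
    2⁻¹ * (∑ j, ∑ k, A j k * (L j k - L k j)) + 2⁻¹ * ∑ i, a i * ∑ j, a j * L j i =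
      ∑ j, ∑ k, A j k * L j k := by
  have h₁ : ∑ i, a i * ∑ j, a j * L j i =
      ∑ j, ∑ k, A j k * L j k + ∑ j, ∑ k, A j k * L k j := by
    rw [Finset.sum_comm (f := fun j k => A j k * L k j), ← Finset.sum_add_distrib]
    simp_rw [Finset.mul_sum]
    rw [Finset.sum_comm]
    refine Finset.sum_congr rfl fun j _ => ?_
    rw [← Finset.sum_add_distrib]
    refine Finset.sum_congr rfl fun k _ => ?_
    linear_combination (-L j k) * hA j k
  rw [h₁]
  simp_rw [mul_sub, Finset.sum_sub_distrib]
  ring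

/-- Expansion of the flow of `rdeDriver` with an error explicit in the size of the
coefficients. -/
theorem abs_flow_expansion_le {F : Type*} [NormedAddCommGroup F] [NormedSpace ℝ F]
    {ℓ : ℕ} {V : F → F} {Vf : Fin ℓ → F → F} {M N Δ : ℝ}
    (hM : 1 ≤ M) (hΔ : 0 ≤ Δ) (hV : CkBoundedBy 2 M V) (hVf : ∀ i, CkBoundedBy 3 M (Vf i))
    (a : EuclideanSpace ℝ (Fin ℓ)) (A : EuclideanSpace ℝ (Fin ℓ × Fin ℓ))
    (hA : ∀ j k, A (j, k) + A (k, j) = a j * a k) {f : F → ℝ} (hf : CkBoundedBy 3 N f)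
    {y : ℝ → F} (hy : ∀ u ∈ Set.Icc (0 : ℝ) 1, HasDerivAt y (rdeDriver ℓ V Vf a A Δ (y u)) u)
    {S Q : ℝ} (hS : ∑ i, |a i| ≤ S) (hQ : ∑ j, ∑ k, |A (j, k)| ≤ Q) :
    |f (y 1) - f (y 0) - Δ * lieDeriv V f (y 0) - (∑ i, a i * lieDeriv (Vf i) f (y 0)) -
        ∑ j, ∑ k, A (j, k) * lieDeriv (Vf j) (lieDeriv (Vf k) f) (y 0)| ≤
      8 * N * M ^ 4 * (Δ * (Δ + S + Q) + S * (Δ + S * (Δ + S + Q) + Q) + Q * (Δ + S + Q)) := by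
  have hN := hf.bound_nonneg
  have hS0 : 0 ≤ S := (Finset.sum_nonneg fun _ _ => abs_nonneg _).trans hS
  have hQ0 : 0 ≤ Q :=
    (Finset.sum_nonneg fun _ _ => Finset.sum_nonneg fun _ _ => abs_nonneg _).trans hQ
  set D := rdeDriver ℓ V Vf a A Δ
  set R := M ^ 2 * (Δ + S + Q)
  have hR0 : 0 ≤ R := by positivity
  have hD (x : F) : ‖D x‖ ≤ R :=
    (norm_rdeDriver_le a A hM hΔ hV hVf x).trans (by simp only [R]; gcongr)
  have hLV : CkBoundedBy 2 (4 * N * M) (lieDeriv V f) :=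
    (hf.lieDeriv (n := 2) hV).mono le_rfl (by norm_num)
  have hL (k) : CkBoundedBy 2 (4 * N * M) (lieDeriv (Vf k) f) :=
    (hf.lieDeriv ((hVf k).mono (m := 2) (by norm_num) le_rfl)).mono le_rfl (by norm_num)
  have hLL (j k) : CkBoundedBy 1 (8 * N * M ^ 2) (lieDeriv (Vf j) (lieDeriv (Vf k) f)) :=
    ((hL k).lieDeriv ((hVf j).mono (m := 1) (by norm_num) le_rfl)).mono le_rfl
      (by ring_nf; rfl)
  have hVd (k) : Differentiable ℝ (Vf k) := (hVf k).differentiable (by norm_num)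
  have hf2 : ContDiff ℝ 2 f := hf.1.of_le (by norm_num)
  have first_order (i) {u : ℝ} (hu : u ∈ Set.Icc (0 : ℝ) 1) :
      |lieDeriv (Vf i) f (y u) - lieDeriv (Vf i) f (y 0) -
        u * ∑ j, a j * lieDeriv (Vf j) (lieDeriv (Vf i) f) (y 0)| ≤
      Δ * (4 * N * M * M) + S * (8 * N * M ^ 2 * R) + 2⁻¹ * (Q * (4 * N * M * (2 * M ^ 2))) := by
    refine abs_comp_flow_sub_le ((hL i).differentiable (by norm_num)) hy (fun r hr => ?_) hu
    rw [lieDeriv_rdeDriver]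
    have e₁ : |Δ * lieDeriv V (lieDeriv (Vf i) f) (y r)| ≤ Δ * (4 * N * M * M) := by
      rw [abs_mul, abs_of_nonneg hΔ]
      gcongr
      exact (hL i).abs_lieDeriv_le (by norm_num) hV.norm_le _
    have e₂ : |∑ j, a j * (lieDeriv (Vf j) (lieDeriv (Vf i) f) (y r) -
        lieDeriv (Vf j) (lieDeriv (Vf i) f) (y 0))| ≤ S * (8 * N * M ^ 2 * R) :=
      (abs_sum_mul_le _ _ fun j => (hLL j i).abs_comp_flow_sub_le le_rfl hy hD hr).trans
        (mul_le_mul_of_nonneg_right hS (by positivity))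
    have e₃ : |2⁻¹ * ∑ j, ∑ k, A (j, k) * lieDeriv (bracket (Vf j) (Vf k))
        (lieDeriv (Vf i) f) (y r)| ≤ 2⁻¹ * (Q * (4 * N * M * (2 * M ^ 2))) := by
      rw [abs_mul, abs_of_nonneg (by norm_num : (0 : ℝ) ≤ 2⁻¹)]
      gcongr
      exact (abs_sum_sum_mul_le _ _ fun j k => (hL i).abs_lieDeriv_le (by norm_num)
        (norm_bracket_le (by norm_num) (hVf j) (hVf k)) _).trans
        (mul_le_mul_of_nonneg_right hQ (by positivity))
    refine le_trans (le_of_eq ?_) ((abs_add_three _ _ _).trans (add_le_add_three e₁ e₂ e₃))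
    simp_rw [mul_sub, Finset.sum_sub_distrib]
    ring_nf
  have main := abs_sub_sub_le_of_hasDerivAt (g := fun u => f (y u))
    (a := Δ * lieDeriv V f (y 0) + ∑ i, a i * lieDeriv (Vf i) f (y 0) +
      2⁻¹ * ∑ j, ∑ k, A (j, k) * (lieDeriv (Vf j) (lieDeriv (Vf k) f) (y 0) -
        lieDeriv (Vf k) (lieDeriv (Vf j) f) (y 0)))
    (b := ∑ i, a i * ∑ j, a j * lieDeriv (Vf j) (lieDeriv (Vf i) f) (y 0))
    (ε := Δ * (4 * N * M * R) + S * (Δ * (4 * N * M * M) + S * (8 * N * M ^ 2 * R) +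
      2⁻¹ * (Q * (4 * N * M * (2 * M ^ 2)))) + 2⁻¹ * (Q * (2 * (8 * N * M ^ 2 * R))))
    (fun u hu => hasDerivAt_comp_flow (hf.differentiable (by norm_num)) (hy u hu))
    (fun u hu => ?_)
  · have halg := sum_antisymm_add_sum_symm (fun i => a i) (fun j k => A (j, k))
      (fun j k => lieDeriv (Vf j) (lieDeriv (Vf k) f) (y 0)) hA
    refine le_trans (le_of_eq ?_) (main.trans ?_)
    · rw [← halg]
      ring_nf
    · have h24 : M ^ 2 ≤ M ^ 4 := pow_le_pow_right₀ hM (by norm_num)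
      have h34 : M ^ 3 ≤ M ^ 4 := pow_le_pow_right₀ hM (by norm_num)
      calc _ = N * (4 * (Δ * (Δ + S + Q)) * M ^ 3 + 4 * (S * Δ) * M ^ 2 +
            8 * (S * (S * (Δ + S + Q))) * M ^ 4 + 4 * (S * Q) * M ^ 3 +
            8 * (Q * (Δ + S + Q)) * M ^ 4) := by simp only [R]; ring
        _ ≤ N * (8 * (Δ * (Δ + S + Q)) * M ^ 4 + 8 * (S * Δ) * M ^ 4 +
            8 * (S * (S * (Δ + S + Q))) * M ^ 4 + 8 * (S * Q) * M ^ 4 +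
            8 * (Q * (Δ + S + Q)) * M ^ 4) := by gcongr <;> norm_num
        _ = _ := by ring
  · rw [lieDeriv_rdeDriver]
    simp_rw [lieDeriv_bracket hf2 (hVd _) (hVd _)]
    have e₁ : |Δ * (lieDeriv V f (y u) - lieDeriv V f (y 0))| ≤ Δ * (4 * N * M * R) := by
      rw [abs_mul, abs_of_nonneg hΔ]
      gcongr
      exact hLV.abs_comp_flow_sub_le (by norm_num) hy hD hu
    have e₂ := (abs_sum_mul_le (fun i => a i) _ fun i => first_order i hu).trans
      (mul_le_mul_of_nonneg_right hS (by positivity))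
    have e₃ : |2⁻¹ * ∑ j, ∑ k, A (j, k) *
        ((lieDeriv (Vf j) (lieDeriv (Vf k) f) (y u) - lieDeriv (Vf j) (lieDeriv (Vf k) f) (y 0)) -
        (lieDeriv (Vf k) (lieDeriv (Vf j) f) (y u) - lieDeriv (Vf k) (lieDeriv (Vf j) f) (y 0)))| ≤
        2⁻¹ * (Q * (2 * (8 * N * M ^ 2 * R))) := by
      rw [abs_mul, abs_of_nonneg (by norm_num : (0 : ℝ) ≤ 2⁻¹)]
      gcongr
      refine (abs_sum_sum_mul_le _ _ fun j k => ?_).trans (mul_le_mul_of_nonneg_right hQ ?_)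
      · rw [two_mul]
        exact (abs_sub _ _).trans (add_le_add
          ((hLL j k).abs_comp_flow_sub_le le_rfl hy hD hu)
          ((hLL k j).abs_comp_flow_sub_le le_rfl hy hD hu))
      · positivity
    have hu_out : ∑ i, a i * (u * ∑ j, a j * lieDeriv (Vf j) (lieDeriv (Vf i) f) (y 0)) =
        u * ∑ i, a i * ∑ j, a j * lieDeriv (Vf j) (lieDeriv (Vf i) f) (y 0) := by
      rw [Finset.mul_sum]
      exact Finset.sum_congr rfl fun i _ => mul_left_comm _ _ _
    refine le_trans (le_of_eq ?_) ((abs_add_three _ _ _).trans (add_le_add_three e₁ e₂ e₃))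
    simp only [mul_sub, Finset.sum_sub_distrib, hu_out]
    ring_nf

theorem error_polynomial_le {B K δ Δ S Q : ℝ} (hB : 1 ≤ B) (hK : 0 ≤ K) (hδ : 0 ≤ δ)
    (hδB : δ ≤ B) (hΔ0 : 0 ≤ Δ) (hΔ : Δ ≤ B * δ ^ 2) (hS : S = B * K * δ)
    (hQ : Q = B * K * δ ^ 2) :
    Δ * (Δ + S + Q) + S * (Δ + S * (Δ + S + Q) + Q) + Q * (Δ + S + Q) ≤
      8 * B ^ 4 * (1 + K ^ 3) * δ ^ 3 := by
  have hS0 : 0 ≤ S := by rw [hS]; positivity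
  have hQ0 : 0 ≤ Q := by rw [hQ]; positivity
  have hP : Δ + S + Q ≤ 2 * B ^ 2 * (1 + K) * δ := by
    calc Δ + S + Q ≤ B * (δ * δ) + B * K * δ + B * K * (δ * δ) := by rw [hS, hQ, ← sq]; gcongr
      _ ≤ B * (B * δ) + B * K * (B * δ) + B * K * (B * δ) := by gcongr; nlinarith
      _ ≤ 2 * B ^ 2 * (1 + K) * δ := by nlinarith [mul_nonneg (sq_nonneg B) hδ]
  have h24 : B ^ 2 ≤ B ^ 4 := pow_le_pow_right₀ hB (by norm_num)
  have h34 : B ^ 3 ≤ B ^ 4 := pow_le_pow_right₀ hB (by norm_num)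
  calc _ ≤ B * δ ^ 2 * (2 * B ^ 2 * (1 + K) * δ) +
        S * (B * δ ^ 2 + S * (2 * B ^ 2 * (1 + K) * δ) + Q) +
        Q * (2 * B ^ 2 * (1 + K) * δ) := by gcongr
    _ = (2 * (1 + K) * B ^ 3 + K * B ^ 2 + 2 * K ^ 2 * (1 + K) * B ^ 4 + K ^ 2 * B ^ 2 +
        2 * K * (1 + K) * B ^ 3) * δ ^ 3 := by rw [hS, hQ]; ring
    _ ≤ (2 * (1 + K) * B ^ 4 + K * B ^ 4 + 2 * K ^ 2 * (1 + K) * B ^ 4 + K ^ 2 * B ^ 4 +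
        2 * K * (1 + K) * B ^ 4) * δ ^ 3 := by gcongr
    _ = (2 + 5 * K + 5 * K ^ 2 + 2 * K ^ 3) * (B ^ 4 * δ ^ 3) := by ring
    _ ≤ (8 * (1 + K ^ 3)) * (B ^ 4 * δ ^ 3) := by
        gcongr
        nlinarith [mul_nonneg (add_nonneg zero_le_one hK) (sq_nonneg (K - 1))]
    _ = _ := by ring

theorem sum_abs_le_card_mul_norm {ι : Type*} [Fintype ι] (a : EuclideanSpace ℝ ι) :
    ∑ i, |a i| ≤ Fintype.card ι * ‖a‖ := by
  calc ∑ i, |a i| ≤ ∑ _i : ι, ‖a‖ := Finset.sum_le_sum fun i _ => PiLp.norm_apply_le a i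
    _ = _ := by simp

/-- **Euler expansion of the approximate flow.**  There is a constant `c > 0` depending
only on the vector fields such that, for every weak geometric Hölder `p`-rough path
`(X, 𝕏)` with `‖X‖ ≤ K`, the time-1 map `μ_{ts}` of the ODE driven by `rdeDriver`
satisfies, for every `C³_b` function `f`,
`‖f ∘ μ_{ts} - {f + (t-s) Vf + X^i_{ts} V_i f + 𝕏^{jk}_{ts} V_j V_k f}‖_∞
  ≤ c (1 + K³) ‖f‖_{C³} |t-s|^{3/p}`. -/
theorem euler_expansion_approximate_flow
    (ℓ : ℕ) (T p : ℝ) (hT : 0 < T) (hp1 : 2 ≤ p) (hp2 : p < 3)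
    (V : E → E) (Vf : Fin ℓ → E → E)
    (hV : CkbMap 2 V) (hVf : ∀ i, CkbMap 3 (Vf i)) :
    ∃ c > (0:ℝ),
      ∀ (X : ℝ → ℝ → EuclideanSpace ℝ (Fin ℓ))
        (XX : ℝ → ℝ → EuclideanSpace ℝ (Fin ℓ × Fin ℓ)),
      ContinuousOn (fun q : ℝ × ℝ => X q.2 q.1)
        {q : ℝ × ℝ | 0 ≤ q.1 ∧ q.1 ≤ q.2 ∧ q.2 ≤ T} →
      ContinuousOn (fun q : ℝ × ℝ => XX q.2 q.1)
        {q : ℝ × ℝ | 0 ≤ q.1 ∧ q.1 ≤ q.2 ∧ q.2 ≤ T} →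
      (∀ s u t : ℝ, 0 ≤ s → s ≤ u → u ≤ t → t ≤ T →
        X t s = X t u + X u s ∧
        ∀ q : Fin ℓ × Fin ℓ, XX t s q = XX t u q + XX u s q + X u s q.1 * X t u q.2) →
      (∀ s t : ℝ, 0 ≤ s → s ≤ t → t ≤ T → ∀ j k : Fin ℓ,
        XX t s (j, k) + XX t s (k, j) = X t s j * X t s k) →
      ∀ K : ℝ, 0 ≤ K →
      (∀ s t : ℝ, 0 ≤ s → s ≤ t → t ≤ T →
        ‖X t s‖ ≤ K * (t - s) ^ (1 / p) ∧ ‖XX t s‖ ≤ K * (t - s) ^ (2 / p)) →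
      ∀ μ : ℝ → ℝ → E → E,
      (∀ s t : ℝ, 0 ≤ s → s ≤ t → t ≤ T → ∀ x : E, ∃ y : ℝ → E,
        y 0 = x ∧ y 1 = μ t s x ∧ ∀ u ∈ Set.Icc (0:ℝ) 1,
          HasDerivAt y (rdeDriver ℓ V Vf (X t s) (XX t s) (t - s) (y u)) u) →
      ∀ s t : ℝ, 0 ≤ s → s ≤ t → t ≤ T →
      ∀ f : E → ℝ, CkbMap 3 f →
      ∀ x : E,
        |f (μ t s x) - f x - (t - s) * fderiv ℝ f x (V x)
            - (∑ i : Fin ℓ, X t s i * fderiv ℝ f x (Vf i x))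
            - ∑ j : Fin ℓ, ∑ k : Fin ℓ, XX t s (j, k) *
                fderiv ℝ (fun y => fderiv ℝ f y (Vf k y)) x (Vf j x)| ≤
          c * (1 + K ^ 3) * C3norm f * (t - s) ^ (3 / p) := by
  have hM : ∃ M : ℝ, 1 ≤ M ∧ CkBoundedBy 2 M V ∧ ∀ i, CkBoundedBy 3 M (Vf i) := by
    obtain ⟨M₀, hM₀⟩ := hV.exists_ckBoundedBy
    choose m hm using fun i => (hVf i).exists_ckBoundedBy
    have hm0 : 0 ≤ ∑ i, m i := Finset.sum_nonneg fun i _ => (hm i).bound_nonneg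
    have hM0 := hM₀.bound_nonneg
    refine ⟨1 + M₀ + ∑ i, m i, by linarith, hM₀.mono le_rfl (by linarith), fun i =>
      (hm i).mono le_rfl ?_⟩
    have := Finset.single_le_sum (f := m) (fun i _ => (hm i).bound_nonneg) (Finset.mem_univ i)
    linarith
  obtain ⟨M, hM1, hMV, hMVf⟩ := hM
  set B : ℝ := (1 + T) * (1 + ℓ + ℓ * ℓ)
  have hℓ : (0 : ℝ) ≤ ℓ := ℓ.cast_nonneg
  have hTB : 1 + T ≤ B := le_mul_of_one_le_right (by positivity) (by nlinarith)
  have hℓB : 1 + ℓ + ℓ * ℓ ≤ B := le_mul_of_one_le_left (by positivity) (by linarith)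
  refine ⟨64 * M ^ 4 * B ^ 4, by positivity, ?_⟩
  intro X XX _ _ _ hsymm K hK hXK μ hμ s t hs hst htT f hf x
  obtain ⟨y, rfl, hy1, hy⟩ := hμ s t hs hst htT x
  have hΔ : 0 ≤ t - s := sub_nonneg.2 hst
  have hp : 0 < p := by linarith
  set δ : ℝ := (t - s) ^ (1 / p)
  have hδ : 0 ≤ δ := Real.rpow_nonneg hΔ _
  have hpow (n : ℕ) : (t - s) ^ ((n : ℝ) / p) = δ ^ n := by
    rw [← Real.rpow_natCast, ← Real.rpow_mul hΔ]
    congr 1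
    ring
  have hrpow {r : ℝ} (hr0 : 0 ≤ r) (hr1 : r ≤ 1) : (t - s) ^ r ≤ 1 + T :=
    calc (t - s) ^ r ≤ (1 + T) ^ r := Real.rpow_le_rpow hΔ (by linarith) hr0
      _ ≤ (1 + T) ^ (1 : ℝ) := Real.rpow_le_rpow_of_exponent_le (by linarith) hr1
      _ = 1 + T := Real.rpow_one _
  have hδB : δ ≤ B := (hrpow (by positivity) (by rw [div_le_one hp]; linarith)).trans hTB
  have hΔB : t - s ≤ B * δ ^ 2 := by
    have h2p : 2 / p ≤ 1 := by rw [div_le_one hp]; exact hp1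
    have h2p0 : 0 < 2 / p := by positivity
    calc t - s = (t - s) ^ ((1 - 2 / p) + 2 / p) := by simp
      _ = (t - s) ^ (1 - 2 / p) * (t - s) ^ (2 / p) :=
          Real.rpow_add_of_nonneg hΔ (by linarith) h2p0.le
      _ ≤ B * (t - s) ^ (2 / p) := by
          gcongr
          exact (hrpow (by linarith) (by linarith)).trans hTB
      _ = B * δ ^ 2 := by rw [← hpow 2]; norm_num
  obtain ⟨hX, hXX⟩ := hXK s t hs hst htT
  have hS : ∑ i, |X t s i| ≤ B * K * δ :=
    calc ∑ i, |X t s i| ≤ ℓ * ‖X t s‖ := by simpa using sum_abs_le_card_mul_norm (X t s)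
      _ ≤ B * (K * δ) := by gcongr; nlinarith
      _ = B * K * δ := by ring
  have hQ : ∑ j, ∑ k, |XX t s (j, k)| ≤ B * K * δ ^ 2 :=
    calc ∑ j, ∑ k, |XX t s (j, k)| ≤ (ℓ * ℓ) * ‖XX t s‖ := by
          rw [← Fintype.sum_prod_type']
          simpa using sum_abs_le_card_mul_norm (XX t s)
      _ ≤ B * (K * (t - s) ^ (2 / p)) := by gcongr; nlinarith
      _ = B * K * δ ^ 2 := by rw [← hpow 2]; norm_num; ring
  have hfN := hf.ckBoundedBy_C3norm
  have hN := hfN.bound_nonneg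
  rw [← hy1]
  refine (abs_flow_expansion_le hM1 hΔ hMV hMVf (X t s) (XX t s) (hsymm s t hs hst htT) hfN hy
    hS hQ).trans ?_
  calc _ ≤ 8 * C3norm f * M ^ 4 * (8 * B ^ 4 * (1 + K ^ 3) * δ ^ 3) := by
        gcongr
        exact error_polynomial_le (by linarith) hK hδ hδB hΔ hΔB rfl rfl
    _ = _ := by rw [← hpow 3]; norm_num; ring
end
end

section
/- (Well-posedness of the rough differential equation on flows, 2≤p<3.) Let E be a Banach space, V a C²_b vector field and V₁,…,V_ℓ C³_b vector fields on E, and let (X,𝕏) be a weak geometric Hölder p-rough path over ℝ^ℓ on [0,T], 2≤p<3. Let μ_{ts} : E → E be the time-1 map of the ODE ẏ_u = (t−s)V(y_u) + X^i_{ts}V_i(y_u) + ½ 𝕏^{jk}_{ts}[V_j,V_k](y_u). Then there exists exactly one flow φ = (φ_{ts})_{0≤s≤t≤T} on E for which there are constants δ>0 and c>0 with ‖φ_{ts} − μ_{ts}‖_∞ ≤ c|t−s|^{3/p} for all (s,t)∈Δ_T with t−s≤δ. Moreover, each map φ_{ts} is a homeomorphism of E which is Lipschitz continuous with Lipschitz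 continuous inverse, uniformly in (s,t)∈Δ_T. -/
/-!
Statement 15: well-posedness of the rough differential equation on flows, 2 ≤ p < 3
(theorem 4.5 / ThmMainResultGeneral).
-/

noncomputable section

variable {E : Type*} [NormedAddCommGroup E] [NormedSpace ℝ E] [CompleteSpace E]

/-- A flow on `E` over the time interval `[0,T]`. -/
def IsFlowOn (T : ℝ) (φ : ℝ → ℝ → E → E) : Prop :=
  (∀ t, 0 ≤ t → t ≤ T → ∀ x, φ t t x = x) ∧
  (∀ s u t, 0 ≤ s → s ≤ u → u ≤ t → t ≤ T → ∀ x, φ t s x = φ t u (φ u s x))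

/-- `φ` is, near the diagonal, uniformly `|t-s|^{3/p}`-close to the time-1 ODE maps
`μ_{ts}`. -/
def IsApproximatedBy (T p : ℝ) (μ φ : ℝ → ℝ → E → E) : Prop :=
  ∃ δ > (0:ℝ), ∃ c > (0:ℝ), ∀ s t : ℝ, 0 ≤ s → s ≤ t → t ≤ T → t - s ≤ δ →
    ∀ x : E, ‖φ t s x - μ t s x‖ ≤ c * (t - s) ^ (3 / p)

set_option linter.unusedSectionVars false

/-! ### Vector fields with quantitative derivative bounds -/

/-- `W` is `C^k` and all its derivatives up to order `k` are bounded by `A`. -/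
def CkBound (k : ℕ) (A : ℝ) (W : E → E) : Prop :=
  ContDiff ℝ k W ∧ ∀ i ≤ k, ∀ x : E, ‖iteratedFDeriv ℝ i W x‖ ≤ A

/-- `f` is bounded by `C` and `C`-Lipschitz. -/
def BoundedLipschitz (C : ℝ) (f : E → E) : Prop :=
  (∀ x, ‖f x‖ ≤ C) ∧ ∀ x y, ‖f x - f y‖ ≤ C * ‖x - y‖

/-- The derivative of `W` along `F`. -/
def derivAlong (W F : E → E) : E → E := fun x => fderiv ℝ W x (F x)

lemma CkbMap.exists_ckBound {k : ℕ} {W : E → E} (h : CkbMap k W) :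
    ∃ A, 0 ≤ A ∧ CkBound k A W := by
  obtain ⟨h1, h2⟩ := h
  choose! M hM using h2
  refine ⟨∑ i ∈ Finset.range (k + 1), |M i|, by positivity, h1, fun i hi x => ?_⟩
  calc _ ≤ M i := hM i hi x
    _ ≤ |M i| := le_abs_self _
    _ ≤ _ := Finset.single_le_sum (f := fun i => |M i|) (fun _ _ => abs_nonneg _)
      (Finset.mem_range.2 (by omega))

namespace CkBound

lemma mono {k m : ℕ} {A B : ℝ} {W : E → E} (h : CkBound k A W) (hm : m ≤ k) (hA : A ≤ B) :
    CkBound m B W :=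
  ⟨h.1.of_le (by exact_mod_cast hm), fun i hi x => (h.2 i (hi.trans hm) x).trans hA⟩

lemma zero (k : ℕ) : CkBound k 0 (fun _ : E => (0 : E)) :=
  ⟨contDiff_const, fun i _ x => by
    simp [iteratedFDeriv_fun_zero]⟩

lemma add {k : ℕ} {A B : ℝ} {W W' : E → E} (h : CkBound k A W) (h' : CkBound k B W') :
    CkBound k (A + B) (fun x => W x + W' x) := by
  refine ⟨h.1.add h'.1, fun i hi x => ?_⟩
  have e : (fun x => W x + W' x) = W + W' := rfl
  rw [e, iteratedFDeriv_add_apply (h.1.contDiffAt.of_le (by exact_mod_cast hi))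
    (h'.1.contDiffAt.of_le (by exact_mod_cast hi))]
  exact (norm_add_le _ _).trans (add_le_add (h.2 i hi x) (h'.2 i hi x))

lemma const_smul {k : ℕ} {A : ℝ} {W : E → E} (h : CkBound k A W) (c : ℝ) :
    CkBound k (|c| * A) (fun x => c • W x) := by
  refine ⟨h.1.const_smul c, fun i hi x => ?_⟩
  have e : (fun x => c • W x) = c • W := rfl
  rw [e, iteratedFDeriv_const_smul_apply (h.1.contDiffAt.of_le (by exact_mod_cast hi)),
    norm_smul, Real.norm_eq_abs]
  exact mul_le_mul_of_nonneg_left (h.2 i hi x) (abs_nonneg c)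

lemma sum {ι : Type*} (s : Finset ι) {k : ℕ} {A : ι → ℝ} {W : ι → E → E}
    (h : ∀ i ∈ s, CkBound k (A i) (W i)) :
    CkBound k (∑ i ∈ s, A i) (fun x => ∑ i ∈ s, W i x) := by
  classical
  induction s using Finset.induction_on with
  | empty => simpa using zero (E := E) k
  | insert a s ha ih =>
    simp only [Finset.sum_insert ha]
    exact (h a (by simp)).add (ih fun i hi => h i (by simp [hi]))

lemma derivAlong {k : ℕ} {A B : ℝ} {W F : E → E} (hA : 0 ≤ A) (hW : CkBound (k + 1) A W)
    (hF : CkBound k B F) : CkBound k (2 ^ k * (A * B)) (derivAlong W F) := by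
  have hB : 0 ≤ B := (norm_nonneg _).trans (hF.2 0 (by omega) 0)
  have hd : ContDiff ℝ k (fderiv ℝ W) := hW.1.fderiv_right (by norm_cast)
  refine ⟨hd.clm_apply hF.1, fun i hi x => ?_⟩
  refine (norm_iteratedFDeriv_clm_apply hd hF.1 x (by exact_mod_cast hi)).trans ?_
  calc _ ≤ ∑ j ∈ Finset.range (i + 1), (i.choose j : ℝ) * (A * B) := by
        refine Finset.sum_le_sum fun j hj => ?_
        have hj : j ≤ i := by simpa [Nat.lt_succ_iff] using hj
        rw [norm_iteratedFDeriv_fderiv, mul_assoc]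
        gcongr
        · exact hW.2 _ (by omega) x
        · exact hF.2 _ (by omega) x
    _ = 2 ^ i * (A * B) := by
        rw [← Finset.sum_mul]
        congr 1
        exact_mod_cast Nat.sum_range_choose i
    _ ≤ _ := by
        gcongr
        norm_num

lemma differentiable {k : ℕ} {A : ℝ} {W : E → E} (h : CkBound (k + 1) A W) :
    Differentiable ℝ W :=
  h.1.differentiable (by simp)

lemma boundedLipschitz {A : ℝ} {W : E → E} (h : CkBound 1 A W) : BoundedLipschitz A W := by
  refine ⟨fun x => by simpa using h.2 0 (by omega) x, fun x y => ?_⟩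
  refine Convex.norm_image_sub_le_of_norm_fderiv_le (𝕜 := ℝ) (s := Set.univ)
    (fun z _ => h.differentiable z) (fun z _ => ?_) convex_univ trivial trivial
  rw [← norm_iteratedFDeriv_one]
  exact h.2 1 le_rfl z

lemma norm_fderiv_le {k : ℕ} {A : ℝ} {W : E → E} (h : CkBound (k + 1) A W) (x : E) :
    ‖fderiv ℝ W x‖ ≤ A := by
  rw [← norm_iteratedFDeriv_one]
  exact h.2 1 (by omega) x

lemma norm_fderiv_sub_le {A : ℝ} {W : E → E} (h : CkBound 2 A W) (x y : E) :
    ‖fderiv ℝ W x - fderiv ℝ W y‖ ≤ A * ‖x - y‖ := by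
  have hd : ContDiff ℝ 1 (fderiv ℝ W) := h.1.fderiv_right (by norm_cast)
  refine Convex.norm_image_sub_le_of_norm_fderiv_le (𝕜 := ℝ) (s := Set.univ)
    (fun z _ => hd.differentiable (by simp) z) (fun z _ => ?_) convex_univ trivial trivial
  rw [← norm_iteratedFDeriv_one, norm_iteratedFDeriv_fderiv]
  exact h.2 2 le_rfl z

/-- A `C^2` bound controls the second difference of a vector field at four points. -/
lemma norm_four_point_le {A : ℝ} {F : E → E} (h : CkBound 2 A F) (a b c d : E) :
    ‖F a - F b - F c + F d‖ ≤
      A * (‖a - b - c + d‖ + (‖a - c‖ + ‖b - d‖) * ‖a - b‖) := by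
  have hA : 0 ≤ A := (norm_nonneg _).trans (h.2 0 (by omega) 0)
  have key : ∀ θ : ℝ, HasDerivAt
      (fun θ : ℝ => F (b + θ • (a - b)) - F (d + θ • (c - d)))
      (fderiv ℝ F (b + θ • (a - b)) (a - b) - fderiv ℝ F (d + θ • (c - d)) (c - d)) θ := by
    intro θ
    have line : ∀ p v : E, HasDerivAt (fun θ : ℝ => p + θ • v) v θ := fun p v => by
      simpa using ((hasDerivAt_id θ).smul_const v).const_add p
    exact ((h.differentiable _).hasFDerivAt.comp_hasDerivAt θ (line b (a - b))).sub
      ((h.differentiable _).hasFDerivAt.comp_hasDerivAt θ (line d (c - d)))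
  have := norm_image_sub_le_of_norm_deriv_le_segment_01'
    (C := A * (‖a - b - c + d‖ + (‖a - c‖ + ‖b - d‖) * ‖a - b‖))
    (fun θ _ => (key θ).hasDerivWithinAt) (fun θ hθ => ?_)
  · have e : F a - F b - F c + F d
        = F (b + (1 : ℝ) • (a - b)) - F (d + (1 : ℝ) • (c - d))
          - (F (b + (0 : ℝ) • (a - b)) - F (d + (0 : ℝ) • (c - d))) := by
      simp only [one_smul, zero_smul, add_sub_cancel, add_zero]; abel
    rw [e]; exact this
  · set P := b + θ • (a - b)
    set Q := d + θ • (c - d)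
    have e : fderiv ℝ F P (a - b) - fderiv ℝ F Q (c - d)
        = fderiv ℝ F Q (a - b - c + d) + (fderiv ℝ F P - fderiv ℝ F Q) (a - b) := by
      simp only [sub_apply, map_sub, map_add]; abel
    have hPQ : ‖P - Q‖ ≤ ‖a - c‖ + ‖b - d‖ := by
      have : P - Q = θ • (a - c) + (1 - θ) • (b - d) := by
        simp only [P, Q]; module
      rw [this]
      refine (norm_add_le _ _).trans (add_le_add ?_ ?_)
      · rw [norm_smul, Real.norm_eq_abs, abs_of_nonneg hθ.1]
        exact mul_le_of_le_one_left (norm_nonneg _) hθ.2.le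
      · rw [norm_smul, Real.norm_eq_abs, abs_of_nonneg (by linarith [hθ.2])]
        exact mul_le_of_le_one_left (norm_nonneg _) (by linarith [hθ.1])
    rw [e, mul_add, ← mul_assoc]
    refine (norm_add_le _ _).trans (add_le_add ?_ ?_)
    · exact (ContinuousLinearMap.le_opNorm _ _).trans
        (mul_le_mul_of_nonneg_right (h.norm_fderiv_le _) (norm_nonneg _))
    · refine (ContinuousLinearMap.le_opNorm _ _).trans
        (mul_le_mul_of_nonneg_right ?_ (norm_nonneg _))
      exact (h.norm_fderiv_sub_le _ _).trans (mul_le_mul_of_nonneg_left hPQ hA)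

end CkBound

namespace BoundedLipschitz

lemma mono {A B : ℝ} {f : E → E} (h : BoundedLipschitz A f) (hAB : A ≤ B) :
    BoundedLipschitz B f :=
  ⟨fun x => (h.1 x).trans hAB, fun x y =>
    (h.2 x y).trans (mul_le_mul_of_nonneg_right hAB (norm_nonneg _))⟩

lemma nonneg {A : ℝ} {f : E → E} (h : BoundedLipschitz A f) : 0 ≤ A :=
  (norm_nonneg _).trans (h.1 0)

lemma add {A B : ℝ} {f g : E → E} (hf : BoundedLipschitz A f) (hg : BoundedLipschitz B g) :
    BoundedLipschitz (A + B) (fun x => f x + g x) := by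
  refine ⟨fun x => (norm_add_le _ _).trans (add_le_add (hf.1 x) (hg.1 x)), fun x y => ?_⟩
  rw [add_sub_add_comm, add_mul]
  exact (norm_add_le _ _).trans (add_le_add (hf.2 x y) (hg.2 x y))

lemma const_smul {A : ℝ} {f : E → E} (hf : BoundedLipschitz A f) (c : ℝ) :
    BoundedLipschitz (|c| * A) (fun x => c • f x) := by
  refine ⟨fun x => ?_, fun x y => ?_⟩
  · rw [norm_smul, Real.norm_eq_abs]
    exact mul_le_mul_of_nonneg_left (hf.1 x) (abs_nonneg c)
  · rw [← smul_sub, norm_smul, Real.norm_eq_abs, mul_assoc]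
    exact mul_le_mul_of_nonneg_left (hf.2 x y) (abs_nonneg c)

lemma sub {A B : ℝ} {f g : E → E} (hf : BoundedLipschitz A f) (hg : BoundedLipschitz B g) :
    BoundedLipschitz (A + B) (fun x => f x - g x) := by
  have := hf.add (hg.const_smul (-1))
  simpa [sub_eq_add_neg] using this

lemma comp {A K : ℝ} {f g : E → E} (hf : BoundedLipschitz A f) (hK : 1 ≤ K)
    (hg : ∀ x y, ‖g x - g y‖ ≤ K * ‖x - y‖) : BoundedLipschitz (A * K) (fun x => f (g x)) := by
  have hA := hf.nonneg
  refine ⟨fun x => (hf.1 _).trans (le_mul_of_one_le_right hA hK), fun x y => ?_⟩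
  rw [mul_assoc]
  exact (hf.2 _ _).trans (mul_le_mul_of_nonneg_left (hg x y) hA)

/-- A family starting from `0` whose derivative is bounded and Lipschitz on `[0,1]` is itself
bounded and Lipschitz. -/
lemma of_hasDerivAt {C : ℝ} {f g : ℝ → E → E} (h0 : ∀ x, f 0 x = 0)
    (hd : ∀ x, ∀ u ∈ Set.Icc (0 : ℝ) 1, HasDerivAt (fun u => f u x) (g u x) u)
    (hg : ∀ u ∈ Set.Icc (0 : ℝ) 1, BoundedLipschitz C (g u)) :
    ∀ u ∈ Set.Icc (0 : ℝ) 1, BoundedLipschitz C (f u) := by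
  intro u hu
  have hC : 0 ≤ C := (hg u hu).nonneg
  refine ⟨fun x => ?_, fun x y => ?_⟩
  · have := norm_image_sub_le_of_norm_deriv_le_segment'
      (fun v hv => (hd x v hv).hasDerivWithinAt)
      (fun v hv => (hg v ⟨hv.1, hv.2.le⟩).1 x) u hu
    rw [h0, sub_zero, sub_zero] at this
    exact this.trans (mul_le_of_le_one_right hC hu.2)
  · have := norm_image_sub_le_of_norm_deriv_le_segment'
      (fun v hv => ((hd x v hv).sub (hd y v hv)).hasDerivWithinAt)
      (fun v hv => (hg v ⟨hv.1, hv.2.le⟩).2 x y) u hu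
    simp only [Pi.sub_apply, h0, sub_zero] at this
    exact this.trans (mul_le_of_le_one_right (by positivity) hu.2)

end BoundedLipschitz

/-! ### Autonomous differential equations on `[0,1]` -/

/-- `Y u x` is, for `u ∈ [0,1]`, a solution at time `u` of `y' = F(y)` started from `x`. -/
def IsSolutionMap (F : E → E) (Y : ℝ → E → E) : Prop :=
  (∀ x, Y 0 x = x) ∧
    ∀ x, ∀ u ∈ Set.Icc (0 : ℝ) 1, HasDerivAt (fun u => Y u x) (F (Y u x)) u

namespace IsSolutionMap

variable {F : E → E} {Y : ℝ → E → E}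

lemma continuousOn (hY : IsSolutionMap F Y) (x : E) :
    ContinuousOn (fun u => Y u x) (Set.Icc 0 1) :=
  fun u hu => (hY.2 x u hu).continuousAt.continuousWithinAt

lemma norm_sub_le {B : ℝ} (hY : IsSolutionMap F Y) (hF : BoundedLipschitz B F) {u : ℝ}
    (hu : u ∈ Set.Icc (0 : ℝ) 1) (x y : E) :
    ‖Y u x - Y u y‖ ≤ Real.exp B * ‖x - y‖ := by
  have hB := hF.nonneg
  have hl : ∀ _ : ℝ, LipschitzWith ⟨B, hB⟩ F := fun _ =>
    LipschitzWith.of_dist_le_mul fun x y => by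
      rw [dist_eq_norm, dist_eq_norm]; exact hF.2 x y
  have := dist_le_of_trajectories_ODE (v := fun _ => F) hl (hY.continuousOn x)
    (fun v hv => (hY.2 x v ⟨hv.1, hv.2.le⟩).hasDerivWithinAt) (hY.continuousOn y)
    (fun v hv => (hY.2 y v ⟨hv.1, hv.2.le⟩).hasDerivWithinAt) le_rfl u hu
  simp only [dist_eq_norm, hY.1, sub_zero] at this
  rw [mul_comm]
  refine this.trans (mul_le_mul_of_nonneg_left (Real.exp_le_exp.2 ?_) (norm_nonneg _))
  exact mul_le_of_le_one_right hB hu.2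

lemma boundedLipschitz_sub_id {B : ℝ} (hY : IsSolutionMap F Y) (hF : BoundedLipschitz B F) :
    BoundedLipschitz (B * Real.exp B) (fun x => Y 1 x - x) := by
  refine BoundedLipschitz.of_hasDerivAt (f := fun u x => Y u x - x)
    (g := fun u x => F (Y u x)) (fun x => by simp [hY.1])
    (fun x u hu => (hY.2 x u hu).sub_const x)
    (fun u hu => hF.comp (Real.one_le_exp hF.nonneg) (hY.norm_sub_le hF hu)) 1 (by simp)

lemma norm_four_point_le {B B₀ : ℝ} (hY : IsSolutionMap F Y) (hF : CkBound 2 B F)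
    (hB₀ : 0 < B₀) (hB : B ≤ B₀) (a b c d : E) :
    ‖Y 1 a - Y 1 b - Y 1 c + Y 1 d - (a - b - c + d)‖ ≤
      B * (2 * Real.exp B₀ ^ 3) *
        (‖a - b - c + d‖ + (‖a - c‖ + ‖b - d‖) * ‖a - b‖) := by
  have hFl : BoundedLipschitz B F := (hF.mono (by omega) le_rfl).boundedLipschitz
  have hBn := hFl.nonneg
  set K := Real.exp B₀ with hK
  have hK1 : 1 ≤ K := Real.one_le_exp hB₀.le
  set M := (‖a - c‖ + ‖b - d‖) * ‖a - b‖ with hM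
  have hM0 : 0 ≤ M := by positivity
  set w : ℝ → E := fun u => Y u a - Y u b - Y u c + Y u d with hw
  set w' : ℝ → E := fun u => F (Y u a) - F (Y u b) - F (Y u c) + F (Y u d) with hw'
  have hd : ∀ u ∈ Set.Icc (0 : ℝ) 1, HasDerivAt w (w' u) u := fun u hu =>
    (((hY.2 a u hu).sub (hY.2 b u hu)).sub (hY.2 c u hu)).add (hY.2 d u hu)
  have hlip : ∀ u ∈ Set.Icc (0 : ℝ) 1, ∀ x y, ‖Y u x - Y u y‖ ≤ K * ‖x - y‖ :=
    fun u hu x y => (hY.norm_sub_le hFl hu x y).trans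
      (mul_le_mul_of_nonneg_right (Real.exp_le_exp.2 hB) (norm_nonneg _))
  have hbd : ∀ u ∈ Set.Icc (0 : ℝ) 1, ‖w' u‖ ≤ B * (‖w u‖ + K ^ 2 * M) := by
    intro u hu
    refine (hF.norm_four_point_le _ _ _ _).trans
      (mul_le_mul_of_nonneg_left (add_le_add le_rfl ?_) hBn)
    calc _ ≤ (K * ‖a - c‖ + K * ‖b - d‖) * (K * ‖a - b‖) := by
          gcongr <;> exact hlip u hu _ _
      _ = K ^ 2 * M := by rw [hM]; ring
  have hw0 : w 0 = a - b - c + d := by simp [hw, hY.1]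
  have hgr : ∀ u ∈ Set.Icc (0 : ℝ) 1, ‖w u‖ ≤ K * ‖w 0‖ + K ^ 3 * M := by
    intro u hu
    have := norm_le_gronwallBound_of_norm_deriv_right_le (K := B₀) (ε := B₀ * (K ^ 2 * M))
      (fun v hv => (hd v hv).continuousAt.continuousWithinAt)
      (fun v hv => (hd v ⟨hv.1, hv.2.le⟩).hasDerivWithinAt) (le_refl ‖w 0‖)
      (fun v hv => by
        refine (hbd v ⟨hv.1, hv.2.le⟩).trans ?_
        rw [← mul_add]
        exact mul_le_mul_of_nonneg_right hB (by positivity)) u hu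
    rw [gronwallBound_of_K_ne_0 hB₀.ne'] at this
    have he : Real.exp (B₀ * (u - 0)) ≤ K := by
      apply Real.exp_le_exp.2
      rw [sub_zero]
      exact mul_le_of_le_one_right hB₀.le hu.2
    have hdiv : B₀ * (K ^ 2 * M) / B₀ = K ^ 2 * M := by field_simp
    rw [hdiv] at this
    have h1 : ‖w 0‖ * Real.exp (B₀ * (u - 0)) ≤ ‖w 0‖ * K :=
      mul_le_mul_of_nonneg_left he (norm_nonneg _)
    have h2 : K ^ 2 * M * (Real.exp (B₀ * (u - 0)) - 1) ≤ K ^ 2 * M * K :=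
      mul_le_mul_of_nonneg_left (by linarith) (by positivity)
    calc _ ≤ _ := this
      _ ≤ ‖w 0‖ * K + K ^ 2 * M * K := add_le_add h1 h2
      _ = _ := by ring
  have hfin := norm_image_sub_le_of_norm_deriv_le_segment_01'
    (C := B * (2 * K ^ 3) * (‖w 0‖ + M))
    (fun u hu => (hd u hu).hasDerivWithinAt) (fun u hu => by
      have hu' : u ∈ Set.Icc (0 : ℝ) 1 := ⟨hu.1, hu.2.le⟩
      refine (hbd u hu').trans ?_
      rw [mul_assoc]
      refine mul_le_mul_of_nonneg_left ?_ hBn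
      have h13 : K ≤ K ^ 3 := le_self_pow₀ hK1 (by norm_num)
      have h23 : K ^ 2 ≤ K ^ 3 := pow_le_pow_right₀ hK1 (by norm_num)
      have := hgr u hu'
      nlinarith [mul_le_mul_of_nonneg_right h13 (norm_nonneg (w 0)),
        mul_le_mul_of_nonneg_right h23 hM0,
        mul_nonneg (pow_nonneg (zero_le_one.trans hK1) 3) (norm_nonneg (w 0))])
  rw [hw0] at hfin
  exact hfin

end IsSolutionMap

/-! ### Second-order expansions -/

/-- `F = F₁ + F₂`, with `F₁` a `C^3` field of size `h` and `F₂` a `C^2` field of size `h ^ 2`. -/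
structure IsGradedField (A h : ℝ) (F₁ F₂ F : E → E) : Prop where
  nonneg_A : 0 ≤ A
  nonneg_h : 0 ≤ h
  h_le_one : h ≤ 1
  bound₁ : CkBound 3 (A * h) F₁
  bound₂ : CkBound 2 (A * h ^ 2) F₂
  eq_add : ∀ x, F x = F₁ x + F₂ x

/-- The constant in second-order expansions along graded fields of size `A`. -/
def expansionConst (A : ℝ) : ℝ := Real.exp (2 * A) * (6 * A ^ 2 + 16 * A ^ 3)

lemma IsSolutionMap.boundedLipschitz_comp_sub {F : E → E} {Y : ℝ → E → E} {a B K : ℝ} {W : E → E}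
    (hY : IsSolutionMap F Y) (ha : 0 ≤ a) (hW : CkBound 2 a W) (hF : CkBound 1 B F)
    (hK : Real.exp B ≤ K) {u : ℝ} (hu : u ∈ Set.Icc (0 : ℝ) 1) :
    BoundedLipschitz (2 * (a * B) * K) (fun x => W (Y u x) - W x) := by
  have hFl := hF.boundedLipschitz
  have hB := hFl.nonneg
  refine BoundedLipschitz.of_hasDerivAt (f := fun u x => W (Y u x) - W x)
    (g := fun u x => derivAlong W F (Y u x)) (fun x => by simp [hY.1]) (fun x v hv => ?_)
    (fun v hv => ?_) u hu
  · exact (((hW.differentiable _).hasFDerivAt).comp_hasDerivAt v (hY.2 x v hv)).sub_const _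
  · have := (CkBound.derivAlong ha hW hF).boundedLipschitz
    rw [pow_one] at this
    refine this.comp ((Real.one_le_exp hB).trans hK) fun x y => ?_
    exact (hY.norm_sub_le hFl hv x y).trans (mul_le_mul_of_nonneg_right hK (norm_nonneg _))

namespace IsGradedField

variable {A h : ℝ} {F₁ F₂ F W₁ W₂ W : E → E} {Y : ℝ → E → E}

lemma ckBound (hF : IsGradedField A h F₁ F₂ F) : CkBound 2 (2 * A * h) F := by
  have hA := hF.nonneg_A
  have hh := hF.nonneg_h
  have h1 := hF.h_le_one
  have := (hF.bound₁.mono (m := 2) (by omega) le_rfl).add hF.bound₂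
  rw [show F = fun x => F₁ x + F₂ x from funext hF.eq_add]
  refine this.mono le_rfl ?_
  nlinarith [mul_nonneg hA (mul_nonneg hh (sub_nonneg.2 h1))]

lemma exp_le (hF : IsGradedField A h F₁ F₂ F) : Real.exp (2 * A * h) ≤ Real.exp (2 * A) :=
  Real.exp_le_exp.2 (mul_le_of_le_one_right (by linarith [hF.nonneg_A]) hF.h_le_one)

lemma norm_solution_sub_le (hF : IsGradedField A h F₁ F₂ F) (hY : IsSolutionMap F Y) {u : ℝ}
    (hu : u ∈ Set.Icc (0 : ℝ) 1) (x y : E) :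
    ‖Y u x - Y u y‖ ≤ Real.exp (2 * A) * ‖x - y‖ :=
  (hY.norm_sub_le (hF.ckBound.mono (by omega) le_rfl).boundedLipschitz hu x y).trans
    (mul_le_mul_of_nonneg_right hF.exp_le (norm_nonneg _))

lemma derivAlong_ckBound (hF : IsGradedField A h F₁ F₂ F) (hW : IsGradedField A h W₁ W₂ W) :
    CkBound 2 (4 * A ^ 2 * h ^ 2) (derivAlong W₁ F₁) := by
  have := CkBound.derivAlong (mul_nonneg hF.nonneg_A hF.nonneg_h) hW.bound₁
    (hF.bound₁.mono (m := 2) (by omega) le_rfl)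
  exact this.mono le_rfl (by ring_nf; rfl)

lemma boundedLipschitz_derivAlong_sub (hF : IsGradedField A h F₁ F₂ F)
    (hW : IsGradedField A h W₁ W₂ W) (hY : IsSolutionMap F Y) {u : ℝ}
    (hu : u ∈ Set.Icc (0 : ℝ) 1) :
    BoundedLipschitz (Real.exp (2 * A) * (16 * A ^ 3) * h ^ 3)
      (fun x => derivAlong W₁ F₁ (Y u x) - derivAlong W₁ F₁ x) := by
  have := hY.boundedLipschitz_comp_sub (by positivity) (hF.derivAlong_ckBound hW)
    (hF.ckBound.mono (by omega) le_rfl) hF.exp_le hu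
  exact this.mono (by ring_nf; rfl)

/-- First-order expansion, with third-order error, of a graded field along the solutions of
another one. -/
lemma boundedLipschitz_expansion (hF : IsGradedField A h F₁ F₂ F)
    (hW : IsGradedField A h W₁ W₂ W) (hY : IsSolutionMap F Y) {u : ℝ}
    (hu : u ∈ Set.Icc (0 : ℝ) 1) :
    BoundedLipschitz (expansionConst A * h ^ 3)
      (fun x => W (Y u x) - W x - u • derivAlong W₁ F₁ x) := by
  have hA := hF.nonneg_A
  have hh := hF.nonneg_h
  have hW₁d : Differentiable ℝ W₁ := hW.bound₁.differentiable
  have hW₂d : Differentiable ℝ W₂ := hW.bound₂.differentiable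
  refine BoundedLipschitz.of_hasDerivAt
    (f := fun u x => W (Y u x) - W x - u • derivAlong W₁ F₁ x)
    (g := fun u x => (derivAlong W₂ F (Y u x) + derivAlong W₁ F₂ (Y u x)) +
      (derivAlong W₁ F₁ (Y u x) - derivAlong W₁ F₁ x))
    (fun x => by simp [hY.1]) (fun x v hv => ?_) (fun v hv => ?_) u hu
  · have h1 : HasDerivAt (fun u => W (Y u x) - W x - u • derivAlong W₁ F₁ x)
        (derivAlong W₁ F (Y v x) + derivAlong W₂ F (Y v x) - (1 : ℝ) • derivAlong W₁ F₁ x) v := by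
      simp only [hW.eq_add]
      exact (((((hW₁d _).hasFDerivAt).comp_hasDerivAt v (hY.2 x v hv)).add
        (((hW₂d _).hasFDerivAt).comp_hasDerivAt v (hY.2 x v hv))).sub_const _).sub
        ((hasDerivAt_id v).smul_const _)
    have h2 : derivAlong W₁ F (Y v x) = derivAlong W₁ F₁ (Y v x) + derivAlong W₁ F₂ (Y v x) := by
      simp only [derivAlong, hF.eq_add, map_add]
    rw [h2] at h1
    convert h1 using 1
    rw [one_smul]; abel
  · have b2 := (CkBound.derivAlong (mul_nonneg hA (pow_nonneg hh 2)) hW.bound₂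
      (hF.ckBound.mono (m := 1) (by omega) le_rfl)).boundedLipschitz
    have b1 := (CkBound.derivAlong (k := 1) (mul_nonneg hA hh)
      (hW.bound₁.mono (by omega) le_rfl)
      (hF.bound₂.mono (m := 1) (by omega) le_rfl)).boundedLipschitz
    have b := ((b2.add b1).comp (Real.one_le_exp (by positivity))
      (hF.norm_solution_sub_le hY hv)).add (hF.boundedLipschitz_derivAlong_sub hW hY hv)
    exact b.mono (by rw [expansionConst]; ring_nf; rfl)

/-- Second-order expansion, with third-order error, of the time-one map of a graded field. -/
lemma boundedLipschitz_solution_expansion (hF : IsGradedField A h F₁ F₂ F)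
    (hY : IsSolutionMap F Y) :
    BoundedLipschitz (expansionConst A * h ^ 3)
      (fun x => Y 1 x - x - F x - (2⁻¹ : ℝ) • derivAlong F₁ F₁ x) := by
  have := BoundedLipschitz.of_hasDerivAt
    (f := fun u x => Y u x - x - u • F x - (u ^ 2 / 2) • derivAlong F₁ F₁ x)
    (g := fun u x => F (Y u x) - F x - u • derivAlong F₁ F₁ x)
    (fun x => by simp [hY.1]) (fun x v hv => ?_)
    (fun v hv => hF.boundedLipschitz_expansion hF hY hv) 1 (by simp)
  · simpa using this
  · have h1 : HasDerivAt (fun u : ℝ => u ^ 2 / 2) v v := by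
      have := ((hasDerivAt_id v).pow 2).div_const 2
      simpa using this
    have := (((hY.2 x v hv).sub_const x).sub ((hasDerivAt_id v).smul_const (F x))).sub
      (h1.smul_const (derivAlong F₁ F₁ x))
    rw [one_smul] at this
    exact this

/-- If three graded fields are related by the truncated Baker-Campbell-Hausdorff identity,
their time-one maps compose up to a third-order error. -/
lemma boundedLipschitz_comp_sub {F₁' F₂' F' F₁'' F₂'' F'' : E → E} {Y' Y'' : ℝ → E → E}
    (hF : IsGradedField A h F₁ F₂ F) (hF' : IsGradedField A h F₁' F₂' F')
    (hF'' : IsGradedField A h F₁'' F₂'' F'') (hY : IsSolutionMap F Y)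
    (hY' : IsSolutionMap F' Y') (hY'' : IsSolutionMap F'' Y'')
    (hbch : ∀ x, F'' x + (2⁻¹ : ℝ) • derivAlong F₁'' F₁'' x =
      (F x + (2⁻¹ : ℝ) • derivAlong F₁ F₁ x) + (F' x + (2⁻¹ : ℝ) • derivAlong F₁' F₁' x)
        + derivAlong F₁' F₁ x) :
    BoundedLipschitz (expansionConst A * (Real.exp (2 * A) + 4) * h ^ 3)
      (fun x => Y' 1 (Y 1 x) - Y'' 1 x) := by
  have hA := hF.nonneg_A
  have hh := hF.nonneg_h
  have h1 : (1 : ℝ) ∈ Set.Icc (0 : ℝ) 1 := by simp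
  have r := hF.boundedLipschitz_solution_expansion hY
  have r' := (hF'.boundedLipschitz_solution_expansion hY').comp (Real.one_le_exp (by positivity))
    (hF.norm_solution_sub_le hY h1)
  have r'' := hF''.boundedLipschitz_solution_expansion hY''
  have e := hF.boundedLipschitz_expansion hF' hY h1
  have d := hY.boundedLipschitz_comp_sub (by positivity) (hF'.derivAlong_ckBound hF')
    (hF.ckBound.mono (by omega) le_rfl) hF.exp_le h1
  have t := (((r'.add e).add (d.const_smul 2⁻¹)).add r).sub r''
  have e1 : (fun x => Y' 1 (Y 1 x) - Y'' 1 x) = fun x =>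
      ((Y' 1 (Y 1 x) - Y 1 x - F' (Y 1 x) - (2⁻¹ : ℝ) • derivAlong F₁' F₁' (Y 1 x))
        + (F' (Y 1 x) - F' x - (1 : ℝ) • derivAlong F₁' F₁ x)
        + (2⁻¹ : ℝ) • (derivAlong F₁' F₁' (Y 1 x) - derivAlong F₁' F₁' x)
        + (Y 1 x - x - F x - (2⁻¹ : ℝ) • derivAlong F₁ F₁ x))
        - (Y'' 1 x - x - F'' x - (2⁻¹ : ℝ) • derivAlong F₁'' F₁'' x) := by
    funext x
    have hx := hbch x
    rw [← eq_sub_iff_add_eq] at hx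
    rw [hx]
    module
  rw [e1]
  refine t.mono ?_
  have hK := Real.exp_pos (2 * A)
  rw [abs_of_pos (by norm_num : (0 : ℝ) < 2⁻¹)]
  have h3 : 0 ≤ Real.exp (2 * A) * A ^ 2 * h ^ 3 := by positivity
  have h4 : 0 ≤ Real.exp (2 * A) * A ^ 3 * h ^ 3 := by positivity
  have e2 : expansionConst A * h ^ 3 = 6 * (Real.exp (2 * A) * A ^ 2 * h ^ 3)
      + 16 * (Real.exp (2 * A) * A ^ 3 * h ^ 3) := by rw [expansionConst]; ring
  nlinarith

end IsGradedField

/-! ### Sewing almost flows -/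

/-- A two-parameter family of maps, close to the identity, which is a flow up to an error of size
`(t - s) ^ a`, uniformly and in Lipschitz norm, for `t - s ≤ δ₀`. -/
structure IsAlmostFlow (T δ₀ C α a : ℝ) (μ : ℝ → ℝ → E → E) : Prop where
  pos_δ₀ : 0 < δ₀
  nonneg_C : 0 ≤ C
  pos_α : 0 < α
  one_lt_a : 1 < a
  near_id : ∀ s t, 0 ≤ s → s ≤ t → t ≤ T → t - s ≤ δ₀ →
    BoundedLipschitz (C * (t - s) ^ α) (fun x => μ t s x - x)
  four_point : ∀ s t, 0 ≤ s → s ≤ t → t ≤ T → t - s ≤ δ₀ → ∀ x y z w,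
    ‖μ t s x - μ t s y - μ t s z + μ t s w - (x - y - z + w)‖ ≤
      C * (t - s) ^ α * (‖x - y - z + w‖ + (‖x - z‖ + ‖y - w‖) * ‖x - y‖)
  defect : ∀ s u t, 0 ≤ s → s ≤ u → u ≤ t → t ≤ T → t - s ≤ δ₀ →
    BoundedLipschitz (C * (t - s) ^ a) (fun x => μ t u (μ u s x) - μ t s x)

/-- The composition of the maps `μ` along `m` consecutive intervals of length `η`, starting from
`i * η`. -/
def gridProd (μ : ℝ → ℝ → E → E) (η : ℝ) (i : ℕ) : ℕ → E → E
  | 0 => id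
  | m + 1 => fun x => μ ((i + m + 1 : ℕ) * η) ((i + m : ℕ) * η) (gridProd μ η i m x)

lemma gridProd_add (μ : ℝ → ℝ → E → E) (η : ℝ) (i m n : ℕ) (x : E) :
    gridProd μ η i (m + n) x = gridProd μ η (i + m) n (gridProd μ η i m x) := by
  induction n with
  | zero => rfl
  | succ n ih =>
    rw [← add_assoc, gridProd, gridProd]
    simp only [ih, add_assoc]

lemma rpow_add_rpow_le {a x y : ℝ} (ha : 1 < a) (hx : 0 ≤ x) (hy : 0 ≤ y)
    (hx' : x ≤ 2 / 3 * (x + y)) (hy' : y ≤ 2 / 3 * (x + y)) :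
    x ^ a + y ^ a ≤ (2 / 3) ^ (a - 1) * (x + y) ^ a := by
  have e : ∀ z : ℝ, 0 ≤ z → z ^ a = z * z ^ (a - 1) := fun z hz => by
    rw [← Real.rpow_one_add' hz (by linarith)]; congr 1; ring
  have h1 := Real.rpow_le_rpow hx hx' (by linarith : 0 ≤ a - 1)
  have h2 := Real.rpow_le_rpow hy hy' (by linarith : 0 ≤ a - 1)
  rw [e x hx, e y hy, e (x + y) (by positivity)]
  rw [Real.mul_rpow (by norm_num) (by positivity)] at h1 h2
  nlinarith [mul_le_mul_of_nonneg_left h1 hx, mul_le_mul_of_nonneg_left h2 hy]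

lemma exists_pos_mul_rpow_le {C α ε : ℝ} (hα : 0 < α) (hε : 0 < ε) :
    ∃ δ > 0, ∀ τ, 0 ≤ τ → τ ≤ δ → C * τ ^ α ≤ ε := by
  have hc : ContinuousAt (fun τ : ℝ => C * τ ^ α) 0 :=
    continuousAt_const.mul (Real.continuousAt_rpow_const 0 α (Or.inr hα.le))
  have h0 : (fun τ : ℝ => C * τ ^ α) 0 < ε := by simpa [Real.zero_rpow hα.ne'] using hε
  obtain ⟨δ, hδ, h⟩ := Metric.eventually_nhds_iff.1 (hc.eventually (gt_mem_nhds h0))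
  refine ⟨δ / 2, by positivity, fun τ h1 h2 => (h ?_).le⟩
  rw [Real.dist_eq, sub_zero, abs_of_nonneg h1]
  linarith

namespace IsAlmostFlow

variable {T δ₀ C α a : ℝ} {μ : ℝ → ℝ → E → E}

lemma norm_sub_le (hμ : IsAlmostFlow T δ₀ C α a μ) {s t ε : ℝ} (hs : 0 ≤ s) (hst : s ≤ t)
    (ht : t ≤ T) (hδ : t - s ≤ δ₀) (hε : C * (t - s) ^ α ≤ ε) (x y : E) :
    ‖μ t s x - μ t s y‖ ≤ (1 + ε) * ‖x - y‖ := by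
  have h := ((hμ.near_id s t hs hst ht hδ).mono hε).2 x y
  have e : μ t s x - μ t s y = (x - y) + (μ t s x - x - (μ t s y - y)) := by abel
  rw [e, add_mul, one_mul]
  exact (norm_add_le _ _).trans (add_le_add le_rfl h)

lemma map_self (hμ : IsAlmostFlow T δ₀ C α a μ) {s : ℝ} (hs : 0 ≤ s) (hT : s ≤ T) (x : E) :
    μ s s x = x := by
  have := (hμ.near_id s s hs le_rfl hT (by simpa using hμ.pos_δ₀.le)).1 x
  rw [sub_self, Real.zero_rpow hμ.pos_α.ne', mul_zero] at this
  exact sub_eq_zero.1 (norm_le_zero_iff.1 this)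

/-- Composing two perturbations of an almost flow. -/
lemma comp_sub (hμ : IsAlmostFlow T δ₀ C α a μ) {s u t ε ρ ρ' : ℝ} {f g : E → E}
    (hs : 0 ≤ s) (hsu : s ≤ u) (hut : u ≤ t) (ht : t ≤ T) (hδ : t - s ≤ δ₀) (hε : ε ≤ 1 / 4)
    (hC : C * (t - s) ^ α ≤ ε) (hρ : ρ ≤ ε)
    (hg : BoundedLipschitz ρ (fun x => g x - μ u s x))
    (hf : BoundedLipschitz ρ' (fun x => f x - μ t u x)) :
    BoundedLipschitz ((1 + 5 * ε) * (ρ + ρ') + C * (t - s) ^ a)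
      (fun x => f (g x) - μ t s x) := by
  have hCn := hμ.nonneg_C
  have hρ0 := hg.nonneg
  have hρ0' := hf.nonneg
  have hα := hμ.pos_α
  have hus : C * (u - s) ^ α ≤ ε := le_trans
    (mul_le_mul_of_nonneg_left (Real.rpow_le_rpow (by linarith) (by linarith) hα.le) hCn) hC
  have htu : C * (t - u) ^ α ≤ ε := le_trans
    (mul_le_mul_of_nonneg_left (Real.rpow_le_rpow (by linarith) (by linarith) hα.le) hCn) hC
  have hμus := hμ.norm_sub_le hs hsu (hut.trans ht) (by linarith) hus
  have hμtu := hμ.norm_sub_le (hs.trans hsu) hut ht (by linarith) htu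
  have hgl : ∀ x y, ‖g x - g y‖ ≤ (1 + 2 * ε) * ‖x - y‖ := fun x y => by
    have e : g x - g y = (μ u s x - μ u s y) + (g x - μ u s x - (g y - μ u s y)) := by abel
    rw [e]
    have h1 := (hg.mono hρ).2 x y
    have h2 := hμus x y
    refine (norm_add_le _ _).trans ?_
    linarith
  have h1 : BoundedLipschitz (ρ' * (1 + 2 * ε)) (fun x => f (g x) - μ t u (g x)) :=
    hf.comp (by linarith) hgl
  have h2 : BoundedLipschitz ((1 + 4 * ε) * ρ) (fun x => μ t u (g x) - μ t u (μ u s x)) := by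
    refine ⟨fun x => ?_, fun x y => ?_⟩
    · have h3 := (hμtu (g x) (μ u s x)).trans
        (mul_le_mul_of_nonneg_left (hg.1 x) (by linarith))
      nlinarith
    · have h4 := hμ.four_point u t (hs.trans hsu) hut ht (by linarith)
        (g x) (μ u s x) (g y) (μ u s y)
      have h5 : ‖g x - μ u s x - g y + μ u s y‖ ≤ ρ * ‖x - y‖ := by
        have := hg.2 x y
        rwa [← sub_add] at this
      have h6 : (‖g x - g y‖ + ‖μ u s x - μ u s y‖) * ‖g x - μ u s x‖
          ≤ (3 * ‖x - y‖) * ρ := by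
        have h7 := hgl x y
        have h8 := hμus x y
        have := hg.1 x
        gcongr
        nlinarith [norm_nonneg (x - y)]
      set D := ‖g x - μ u s x - g y + μ u s y‖ with hD
      have h9 : ‖μ t u (g x) - μ t u (μ u s x) - (μ t u (g y) - μ t u (μ u s y))‖ ≤
          D + ε * (D + (3 * ‖x - y‖) * ρ) := by
        have e : μ t u (g x) - μ t u (μ u s x) - (μ t u (g y) - μ t u (μ u s y))
          = (g x - μ u s x - g y + μ u s y) + (μ t u (g x) - μ t u (μ u s x) - μ t u (g y)
            + μ t u (μ u s y) - (g x - μ u s x - g y + μ u s y)) := by abel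
        rw [e]
        refine (norm_add_le _ _).trans (add_le_add le_rfl (h4.trans ?_))
        refine (mul_le_mul_of_nonneg_right htu (by positivity)).trans ?_
        exact mul_le_mul_of_nonneg_left (add_le_add le_rfl h6) (by linarith)
      have hε0 : 0 ≤ ε := by linarith
      nlinarith
  have h3 := hμ.defect s u t hs hsu hut ht hδ
  have e : (fun x => f (g x) - μ t s x) = fun x => ((f (g x) - μ t u (g x))
      + (μ t u (g x) - μ t u (μ u s x))) + (μ t u (μ u s x) - μ t s x) := by
    funext x; abel
  rw [e]
  exact ((h1.add h2).add h3).mono (by nlinarith)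

/-- Compositions of an almost flow along regular grids stay close to it, uniformly in the mesh
of the grid. -/
lemma exists_gridProd_bound (hμ : IsAlmostFlow T δ₀ C α a μ) :
    ∃ L δ : ℝ, 0 ≤ L ∧ 0 < δ ∧ δ ≤ δ₀ ∧
      (∀ τ, 0 ≤ τ → τ ≤ δ → C * τ ^ α ≤ 1 / 4) ∧
      ∀ (η : ℝ) (i m : ℕ), 0 ≤ η → (i + m : ℕ) * η ≤ T → m * η ≤ δ →
        BoundedLipschitz (L * (m * η) ^ a)
          (fun x => gridProd μ η i m x - μ ((i + m : ℕ) * η) (i * η) x) ∧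
        ∀ x y, ‖gridProd μ η i m x - x - (gridProd μ η i m y - y)‖ ≤ 1 / 2 * ‖x - y‖ := by
  have hC := hμ.nonneg_C
  have ha := hμ.one_lt_a
  have ha0 : 0 < a := by linarith
  set κ : ℝ := (2 / 3) ^ (a - 1) with hκ
  have hκ1 : κ < 1 := Real.rpow_lt_one (by norm_num) (by norm_num) (by linarith)
  have hκ0 : 0 < κ := Real.rpow_pos_of_pos (by norm_num) _
  set ε : ℝ := (1 - κ) / 10 with hε
  set L : ℝ := 2 * C / (1 - κ) with hL
  have hL0 : 0 ≤ L := div_nonneg (by positivity) (by linarith)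
  have hLC : L * (1 - κ) = 2 * C := by rw [hL]; field_simp [(sub_pos.2 hκ1).ne']
  obtain ⟨δ₁, hδ₁, h1⟩ := exists_pos_mul_rpow_le (C := C) hμ.pos_α (by linarith : 0 < ε)
  obtain ⟨δ₂, hδ₂, h2⟩ := exists_pos_mul_rpow_le (C := L) ha0 (by linarith : 0 < ε)
  refine ⟨L, min δ₀ (min δ₁ δ₂), hL0, lt_min hμ.pos_δ₀ (lt_min hδ₁ hδ₂), min_le_left _ _,
    fun τ hτ hτ' => ?_, fun η i m hη hT hm => ?_⟩
  · have := h1 τ hτ (hτ'.trans ((min_le_right _ _).trans (min_le_left _ _)))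
    linarith
  have main : ∀ m : ℕ, ∀ i : ℕ, ((i + m : ℕ) : ℝ) * η ≤ T → m * η ≤ min δ₀ (min δ₁ δ₂) →
      BoundedLipschitz (L * (m * η) ^ a)
        (fun x => gridProd μ η i m x - μ ((i + m : ℕ) * η) (i * η) x) := by
    intro m
    induction m using Nat.strong_induction_on with
    | _ m ih =>
      intro i hT hm
      have hz : ∀ k : ℕ, 0 ≤ L * ((k : ℝ) * η) ^ a := fun k => by positivity
      rcases Nat.lt_or_ge m 2 with hm2 | hm2
      · have e : (fun x => gridProd μ η i m x - μ ((i + m : ℕ) * η) (i * η) x)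
            = fun _ => 0 := by
          funext x
          interval_cases m
          · simp only [gridProd, id, add_zero] at hT ⊢
            rw [hμ.map_self (by positivity) hT, sub_self]
          · simp [gridProd]
        rw [e]
        exact ⟨fun x => by simpa using hz m, fun x y => by
          simpa using mul_nonneg (hz m) (norm_nonneg (x - y))⟩
      · obtain ⟨k, l, hkl, hk, hl, hk3, hl3⟩ : ∃ k l : ℕ, m = k + l ∧ k < m ∧ l < m ∧
            3 * k ≤ 2 * (k + l) ∧ 3 * l ≤ 2 * (k + l) :=
          ⟨m / 2, m - m / 2, by omega, by omega, by omega, by omega, by omega⟩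
        subst hkl
        have hk3' : (3 : ℝ) * k ≤ 2 * (k + l) := by exact_mod_cast hk3
        have hl3' : (3 : ℝ) * l ≤ 2 * (k + l) := by exact_mod_cast hl3
        have hk0 : (0 : ℝ) ≤ k * η := by positivity
        have hl0 : (0 : ℝ) ≤ l * η := by positivity
        push_cast at hT hm
        have hδ0 : ((k : ℝ) + l) * η ≤ δ₀ := hm.trans (min_le_left _ _)
        have hδ1 : ((k : ℝ) + l) * η ≤ δ₁ :=
          hm.trans ((min_le_right _ _).trans (min_le_left _ _))
        have hδ2 : ((k : ℝ) + l) * η ≤ δ₂ :=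
          hm.trans ((min_le_right _ _).trans (min_le_right _ _))
        have hg := ih k hk i (by push_cast; linarith) (by linarith)
        have hf := ih l hl (i + k) (by push_cast; linarith) (by linarith)
        have hts : ((i + (k + l) : ℕ) : ℝ) * η - i * η = k * η + l * η := by push_cast; ring
        have hsum := rpow_add_rpow_le ha hk0 hl0 (by nlinarith) (by nlinarith)
        have step := hμ.comp_sub (s := i * η) (u := (i + k : ℕ) * η)
          (t := (i + (k + l) : ℕ) * η) (ε := ε) (by positivity)
          (by push_cast; linarith) (by push_cast; linarith) (by push_cast; linarith)
          (by rw [hts]; linarith) (by linarith)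
          (by rw [hts]; exact h1 _ (by positivity) (by linarith))
          (h2 _ hk0 (by linarith)) hg (by rw [← add_assoc]; exact hf)
        rw [hts] at step
        have e : (((k + l : ℕ) : ℝ) * η) = k * η + l * η := by push_cast; ring
        rw [e]
        simp only [gridProd_add]
        refine step.mono ?_
        set S := (k * η + l * η) ^ a with hS
        have hS0 : 0 ≤ S := by positivity
        have h3 : L * (k * η) ^ a + L * (l * η) ^ a ≤ L * (κ * S) := by
          rw [← mul_add]; exact mul_le_mul_of_nonneg_left hsum hL0
        have h4 : (1 + 5 * ε) * κ ≤ (1 + κ) / 2 := by rw [hε]; nlinarith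
        calc _ ≤ (1 + 5 * ε) * (L * (κ * S)) + C * S :=
              add_le_add (mul_le_mul_of_nonneg_left h3 (by linarith)) le_rfl
          _ = ((1 + 5 * ε) * κ) * (L * S) + C * S := by ring
          _ ≤ (1 + κ) / 2 * (L * S) + C * S :=
              add_le_add (mul_le_mul_of_nonneg_right h4 (by positivity)) le_rfl
          _ = L * S := by linear_combination (-S / 2) * hLC
  refine ⟨main m i hT hm, fun x y => ?_⟩
  have hmη : (0 : ℝ) ≤ m * η := by positivity
  have hb := (main m i hT hm).2 x y
  have hts : ((i + m : ℕ) : ℝ) * η - i * η = m * η := by push_cast; ring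
  have hn := (hμ.near_id (i * η) ((i + m : ℕ) * η) (by positivity) (by push_cast; linarith) hT
    (by rw [hts]; exact hm.trans (min_le_left _ _))).2 x y
  rw [hts] at hn
  have h3 := h1 _ hmη (hm.trans ((min_le_right _ _).trans (min_le_left _ _)))
  have h4 := h2 _ hmη (hm.trans ((min_le_right _ _).trans (min_le_right _ _)))
  set ν := μ ((i + m : ℕ) * η) (i * η)
  have e : gridProd μ η i m x - x - (gridProd μ η i m y - y)
      = (gridProd μ η i m x - ν x - (gridProd μ η i m y - ν y)) + (ν x - x - (ν y - y)) := by
    abel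
  rw [e]
  refine (norm_add_le _ _).trans ?_
  have h5 := mul_le_mul_of_nonneg_right h3 (norm_nonneg (x - y))
  have h6 := mul_le_mul_of_nonneg_right h4 (norm_nonneg (x - y))
  nlinarith [norm_nonneg (x - y)]

end IsAlmostFlow

/-- The composition of the maps `μ` along the dyadic grid of mesh `2⁻ⁿ`, between the grid points
immediately before `s` and before `t`. -/
def gridFlow (μ : ℝ → ℝ → E → E) (n : ℕ) (t s : ℝ) : E → E :=
  gridProd μ ((1 / 2) ^ n) ⌊s * 2 ^ n⌋₊ (⌊t * 2 ^ n⌋₊ - ⌊s * 2 ^ n⌋₊)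

lemma floor_mul_two_pow_mono {s t : ℝ} (hst : s ≤ t) (n : ℕ) : ⌊s * 2 ^ n⌋₊ ≤ ⌊t * 2 ^ n⌋₊ :=
  Nat.floor_mono (mul_le_mul_of_nonneg_right hst (by positivity))

lemma gridFlow_self (μ : ℝ → ℝ → E → E) (n : ℕ) (t : ℝ) (x : E) : gridFlow μ n t t x = x := by
  simp [gridFlow, gridProd]

lemma gridFlow_comp (μ : ℝ → ℝ → E → E) (n : ℕ) {s u t : ℝ} (hsu : s ≤ u) (hut : u ≤ t) (x : E) :
    gridFlow μ n t s x = gridFlow μ n t u (gridFlow μ n u s x) := by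
  have h1 := floor_mul_two_pow_mono hsu n
  have h2 := floor_mul_two_pow_mono hut n
  have e : ⌊t * 2 ^ n⌋₊ - ⌊s * 2 ^ n⌋₊
      = (⌊u * 2 ^ n⌋₊ - ⌊s * 2 ^ n⌋₊) + (⌊t * 2 ^ n⌋₊ - ⌊u * 2 ^ n⌋₊) := by omega
  rw [gridFlow, e, gridProd_add, Nat.add_sub_cancel' h1]
  rfl

lemma floor_mul_two_pow_mul_le {s : ℝ} (hs : 0 ≤ s) (n : ℕ) :
    (⌊s * 2 ^ n⌋₊ : ℝ) * (1 / 2) ^ n ≤ s := by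
  have h := Nat.floor_le (a := s * 2 ^ n) (by positivity)
  calc _ ≤ s * 2 ^ n * (1 / 2) ^ n := mul_le_mul_of_nonneg_right h (by positivity)
    _ = s := by rw [mul_assoc, ← mul_pow]; norm_num

lemma sub_le_floor_mul_two_pow_mul (s : ℝ) (n : ℕ) :
    s - (1 / 2) ^ n ≤ (⌊s * 2 ^ n⌋₊ : ℝ) * (1 / 2) ^ n := by
  have h := (Nat.lt_floor_add_one (s * 2 ^ n)).le
  have : s * 2 ^ n * (1 / 2) ^ n ≤ ((⌊s * 2 ^ n⌋₊ : ℝ) + 1) * (1 / 2) ^ n :=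
    mul_le_mul_of_nonneg_right h (by positivity)
  rw [mul_assoc, ← mul_pow] at this
  norm_num at this ⊢
  linarith

lemma floor_mul_two_pow_succ {s : ℝ} (hs : 0 ≤ s) (n : ℕ) :
    2 * ⌊s * 2 ^ n⌋₊ ≤ ⌊s * 2 ^ (n + 1)⌋₊ ∧ ⌊s * 2 ^ (n + 1)⌋₊ ≤ 2 * ⌊s * 2 ^ n⌋₊ + 1 := by
  have h0 : 0 ≤ s * 2 ^ n := by positivity
  have h1 := Nat.floor_le h0
  have h2 := Nat.lt_floor_add_one (s * 2 ^ n)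
  have e : s * 2 ^ (n + 1) = 2 * (s * 2 ^ n) := by ring
  rw [e]
  constructor
  · apply Nat.le_floor
    push_cast; linarith
  · rw [← Nat.lt_succ_iff, Nat.floor_lt (by positivity)]
    push_cast; linarith

namespace IsAlmostFlow

variable {T δ₀ C α a : ℝ} {μ : ℝ → ℝ → E → E}

lemma norm_gridProd_sub_le (hμ : IsAlmostFlow T δ₀ C α a μ) {η : ℝ} {i e : ℕ} (he : e ≤ 1)
    (hη : 0 ≤ η) (hηδ : η ≤ δ₀) (hT : (i + e : ℕ) * η ≤ T) (x : E) :
    ‖gridProd μ η i e x - x‖ ≤ C * η ^ α := by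
  interval_cases e
  · simpa [gridProd] using mul_nonneg hμ.nonneg_C (Real.rpow_nonneg hη α)
  · have e1 : ((i + 1 : ℕ) : ℝ) * η - i * η = η := by push_cast; ring
    have := (hμ.near_id (i * η) ((i + 1 : ℕ) * η) (by positivity) (by linarith) hT
      (by rw [e1]; exact hηδ)).1 x
    rw [e1] at this
    simpa [gridProd] using this

/-- Halving the mesh of the grid. -/
lemma norm_gridProd_half_sub_le (hμ : IsAlmostFlow T δ₀ C α a μ) {δ η : ℝ} (hδ : δ ≤ δ₀)
    (hη : 0 ≤ η)
    (hlip : ∀ i m : ℕ, (i + m : ℕ) * η ≤ T → m * η ≤ δ → ∀ x y,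
      ‖gridProd μ η i m x - gridProd μ η i m y‖ ≤ 2 * ‖x - y‖) (m : ℕ) :
    ∀ i : ℕ, (i + m : ℕ) * η ≤ T → m * η ≤ δ → ∀ x,
      ‖gridProd μ (η / 2) (2 * i) (2 * m) x - gridProd μ η i m x‖ ≤ m * (2 * (C * η ^ a)) := by
  induction m with
  | zero => intro i _ _ x; simp [gridProd]
  | succ m ih =>
    intro i hT hm x
    push_cast at hT hm
    have hiη : (0 : ℝ) ≤ i * η := by positivity
    have hmη : (0 : ℝ) ≤ m * η := by positivity
    have e1 : gridProd μ (η / 2) (2 * i) (2 * (m + 1)) x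
        = gridProd μ (η / 2) (2 * (i + 1)) (2 * m) (gridProd μ (η / 2) (2 * i) 2 x) := by
      rw [show 2 * (m + 1) = 2 + 2 * m by ring, gridProd_add]; rfl
    have e2 : gridProd μ η i (m + 1) x = gridProd μ η (i + 1) m (gridProd μ η i 1 x) := by
      rw [add_comm m 1, gridProd_add]
    have h1 := ih (i + 1) (by push_cast; linarith) (by linarith) (gridProd μ (η / 2) (2 * i) 2 x)
    have h2 := hlip (i + 1) m (by push_cast; linarith) (by linarith)
      (gridProd μ (η / 2) (2 * i) 2 x) (gridProd μ η i 1 x)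
    have h3 : ‖gridProd μ (η / 2) (2 * i) 2 x - gridProd μ η i 1 x‖ ≤ C * η ^ a := by
      have hd := (hμ.defect (i * η) (i * η + η / 2) (i * η + η) hiη (by linarith) (by linarith)
        (by linarith) (by linarith)).1 x
      have p0 : ((2 * i : ℕ) : ℝ) * (η / 2) = i * η := by push_cast; ring
      have p1 : ((2 * i + 1 : ℕ) : ℝ) * (η / 2) = i * η + η / 2 := by push_cast; ring
      have p2 : ((2 * i + 1 + 1 : ℕ) : ℝ) * (η / 2) = i * η + η := by push_cast; ring
      have p3 : ((i + 1 : ℕ) : ℝ) * η = i * η + η := by push_cast; ring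
      simp only [gridProd, id, add_zero, p0, p1, p2, p3]
      simpa using hd
    rw [e1, e2]
    refine (norm_sub_le_norm_sub_add_norm_sub _ _ _).trans ((add_le_add h1 h2).trans ?_)
    push_cast
    linarith

/-- The data of a range `δ` and a first generation `N` from which on the dyadic compositions
`gridFlow μ n t s` behave well, uniformly in `n`, for `t - s ≤ δ`. -/
lemma exists_gridFlow_bound (hμ : IsAlmostFlow T δ₀ C α a μ) :
    ∃ (c δ r : ℝ) (N : ℕ), 0 < c ∧ 0 < δ ∧ δ ≤ δ₀ ∧ 0 ≤ r ∧ r < 1 ∧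
      ∀ s t, 0 ≤ s → s ≤ t → t ≤ T → t - s ≤ δ → ∀ n, N ≤ n →
        (∀ x y, ‖gridFlow μ n t s x - x - (gridFlow μ n t s y - y)‖ ≤ 1 / 2 * ‖x - y‖) ∧
        (∀ x, ‖gridFlow μ n t s x - gridFlow μ (n + 1) t s x‖ ≤ c * r ^ n) ∧
        (∀ x, ‖gridFlow μ n t s x - μ t s x‖ ≤
          c * (t - s + (1 / 2) ^ n) ^ a + c * ((1 / 2) ^ n) ^ α) := by
  obtain ⟨L, δ, hL, hδ, hδδ₀, hCα, hgrid⟩ := hμ.exists_gridProd_bound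
  have hC := hμ.nonneg_C
  have ha := hμ.one_lt_a
  have hα := hμ.pos_α
  obtain ⟨N, hN⟩ := exists_pow_lt_of_lt_one (half_pos hδ) (by norm_num : (1 / 2 : ℝ) < 1)
  set β := min α (a - 1) with hβ
  have hβ0 : 0 < β := lt_min hα (by linarith)
  have hlip : ∀ (η : ℝ) (i m : ℕ), 0 ≤ η → (i + m : ℕ) * η ≤ T → m * η ≤ δ → ∀ x y,
      ‖gridProd μ η i m x - gridProd μ η i m y‖ ≤ 2 * ‖x - y‖ := by
    intro η i m hη hT hm x y
    have h := (hgrid η i m hη hT hm).2 x y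
    have e : gridProd μ η i m x - gridProd μ η i m y
        = (gridProd μ η i m x - x - (gridProd μ η i m y - y)) + (x - y) := by abel
    rw [e]
    refine (norm_add_le _ _).trans ?_
    linarith [norm_nonneg (x - y)]
  refine ⟨3 * C + 2 * C * δ + L + 1, δ / 2, (1 / 2) ^ β, N, by positivity, by positivity,
    by linarith, by positivity, Real.rpow_lt_one (by norm_num) (by norm_num) hβ0, ?_⟩
  intro s t hs hst ht hts n hn
  set η : ℝ := (1 / 2) ^ n with hη
  have hη0 : 0 < η := by positivity
  have hηδ : η ≤ δ / 2 := (pow_le_pow_of_le_one (by norm_num) (by norm_num) hn).trans hN.le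
  have hη1 : η ≤ 1 := pow_le_one₀ (by norm_num) (by norm_num)
  obtain ⟨i, hi⟩ : ∃ i, i = ⌊s * 2 ^ n⌋₊ := ⟨_, rfl⟩
  obtain ⟨j, hj⟩ : ∃ j, j = ⌊t * 2 ^ n⌋₊ := ⟨_, rfl⟩
  have hij : i ≤ j := by rw [hi, hj]; exact floor_mul_two_pow_mono hst n
  obtain ⟨m, rfl⟩ := Nat.exists_eq_add_of_le hij
  have hs1 : (i : ℝ) * η ≤ s := by rw [hi]; exact floor_mul_two_pow_mul_le hs n
  have hs2 : s - η ≤ (i : ℝ) * η := by rw [hi]; exact sub_le_floor_mul_two_pow_mul s n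
  have ht1 : ((i + m : ℕ) : ℝ) * η ≤ t := by
    rw [hj]; exact floor_mul_two_pow_mul_le (hs.trans hst) n
  have ht2 : t - η ≤ ((i + m : ℕ) : ℝ) * η := by rw [hj]; exact sub_le_floor_mul_two_pow_mul t n
  have hiη : (0 : ℝ) ≤ i * η := by positivity
  have hmη : (0 : ℝ) ≤ m * η := by positivity
  have hsplit : ((i + m : ℕ) : ℝ) * η = i * η + m * η := by push_cast; ring
  have hmδ : m * η ≤ δ := by linarith
  have hflow : gridFlow μ n t s = gridProd μ η i m := by
    rw [gridFlow, ← hi, ← hj, Nat.add_sub_cancel_left]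
  have hG := hgrid η i m hη0.le (ht1.trans ht) hmδ
  refine ⟨fun x y => by rw [hflow]; exact hG.2 x y, fun x => ?_, fun x => ?_⟩
  · obtain ⟨hi1, hi2⟩ := floor_mul_two_pow_succ hs n
    obtain ⟨hj1, hj2⟩ := floor_mul_two_pow_succ (hs.trans hst) n
    have hij' := floor_mul_two_pow_mono hst (n + 1)
    have ht1' := floor_mul_two_pow_mul_le (hs.trans hst) (n + 1)
    rw [← hi] at hi1 hi2
    rw [← hj] at hj1 hj2
    set i' := ⌊s * 2 ^ (n + 1)⌋₊ with hi'
    set j' := ⌊t * 2 ^ (n + 1)⌋₊ with hj'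
    have hη' : (1 / 2 : ℝ) ^ (n + 1) = η / 2 := by rw [pow_succ, hη]; ring
    rw [hη'] at ht1'
    obtain ⟨e, he⟩ : ∃ e, i' = 2 * i + e := Nat.exists_eq_add_of_le hi1
    obtain ⟨f, hf⟩ : ∃ f, j' = 2 * (i + m) + f := Nat.exists_eq_add_of_le hj1
    obtain ⟨k, hk⟩ : ∃ k, j' = i' + k := Nat.exists_eq_add_of_le hij'
    have he1 : e ≤ 1 := by omega
    have hf1 : f ≤ 1 := by omega
    have hkR : (i' : ℝ) + k = j' := by exact_mod_cast hk.symm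
    have heR : (i' : ℝ) = 2 * i + e := by exact_mod_cast he
    have hfR : (j' : ℝ) = 2 * (i + m) + f := by exact_mod_cast hf
    have he0 : (0 : ℝ) ≤ e := by positivity
    have hf0 : (0 : ℝ) ≤ f := by positivity
    have hk0 : (0 : ℝ) ≤ k := by positivity
    have hf1' : (f : ℝ) ≤ 1 := by exact_mod_cast hf1
    have hflow' : gridFlow μ (n + 1) t s = gridProd μ (η / 2) i' k := by
      rw [gridFlow, ← hi', ← hj', hk, Nat.add_sub_cancel_left, hη']
    have hkT : ((i' + k : ℕ) : ℝ) * (η / 2) ≤ T := by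
      rw [← hk]; exact ht1'.trans ht
    have hkδ : (k : ℝ) * (η / 2) ≤ δ := by
      nlinarith
    have c1 := hμ.norm_gridProd_half_sub_le hδδ₀ hη0.le
      (fun i m h1 h2 x y => hlip η i m hη0.le h1 h2 x y) m i (ht1.trans ht) hmδ x
    have c2 := hμ.norm_gridProd_sub_le (η := η / 2) (i := 2 * (i + m)) hf1 (by positivity)
      (by linarith) (by rw [← hf]; exact ht1'.trans ht)
      (gridProd μ (η / 2) (2 * i) (2 * m) x)
    have c3 := hμ.norm_gridProd_sub_le (η := η / 2) (i := 2 * i) he1 (by positivity)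
      (by linarith) (by
        rw [← he]
        refine le_trans ?_ (ht1'.trans ht)
        gcongr) x
    have c4 := hlip (η / 2) i' k (by positivity) hkT hkδ
      (gridProd μ (η / 2) (2 * i) e x) x
    have e1 : gridProd μ (η / 2) (2 * (i + m)) f (gridProd μ (η / 2) (2 * i) (2 * m) x)
        = gridProd μ (η / 2) i' k (gridProd μ (η / 2) (2 * i) e x) := by
      rw [mul_add, ← gridProd_add, he, ← gridProd_add]
      congr 1
      omega
    rw [hflow, hflow']
    set P₁ := gridProd μ η i m x
    set P₂ := gridProd μ (η / 2) (2 * i) (2 * m) x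
    set P₃ := gridProd μ (η / 2) (2 * (i + m)) f P₂
    set P₄ := gridProd μ (η / 2) i' k x
    rw [← e1] at c4
    have c5 : ‖P₁ - P₄‖ ≤ ‖P₂ - P₁‖ + ‖P₃ - P₂‖ + ‖P₃ - P₄‖ := by
      have : P₁ - P₄ = -(P₂ - P₁) + -(P₃ - P₂) + (P₃ - P₄) := by abel
      rw [this]
      refine (norm_add_le _ _).trans (add_le_add ((norm_add_le _ _).trans ?_) le_rfl)
      rw [norm_neg, norm_neg]
    have hpow : ((1 / 2 : ℝ) ^ β) ^ n = η ^ β := by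
      rw [hη, ← Real.rpow_natCast, ← Real.rpow_natCast, ← Real.rpow_mul (by norm_num),
        ← Real.rpow_mul (by norm_num), mul_comm]
    rw [hpow]
    have d1 : (η / 2) ^ α ≤ η ^ β :=
      (Real.rpow_le_rpow (by positivity) (by linarith) hα.le).trans
        (Real.rpow_le_rpow_of_exponent_ge hη0 hη1 (min_le_left _ _))
    have d2 : η ^ a ≤ η * η ^ β := by
      have : η ^ a = η * η ^ (a - 1) := by
        rw [← Real.rpow_one_add' hη0.le (by linarith)]; congr 1; ring
      rw [this]
      exact mul_le_mul_of_nonneg_left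
        (Real.rpow_le_rpow_of_exponent_ge hη0 hη1 (min_le_right _ _)) hη0.le
    have hηβ : 0 ≤ η ^ β := by positivity
    have d3 : m * (2 * (C * η ^ a)) ≤ 2 * C * δ * η ^ β := by
      calc m * (2 * (C * η ^ a)) ≤ m * (2 * (C * (η * η ^ β))) := by gcongr
        _ = 2 * C * (m * η) * η ^ β := by ring
        _ ≤ _ := by gcongr
    have d4 : C * (η / 2) ^ α ≤ C * η ^ β := mul_le_mul_of_nonneg_left d1 hC
    have d5 : 0 ≤ L * η ^ β := by positivity
    linarith
  · have hS : 0 ≤ t - s + η := by linarith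
    have b1 := hG.1.1 x
    have b2 := (hμ.defect (i * η) ((i + m : ℕ) * η) t hiη (by linarith) ht1 ht
      (by linarith)).1 x
    have b3 := (hμ.near_id ((i + m : ℕ) * η) t (by positivity) ht1 ht (by linarith)).1
      (μ ((i + m : ℕ) * η) (i * η) x)
    have b4 := (hμ.defect (i * η) s t hiη hs1 hst ht (by linarith)).1 x
    have b5 := hμ.norm_sub_le hs hst ht (by linarith)
      (hCα (t - s) (by linarith) (by linarith)) (μ s (i * η) x) x
    have b6 := (hμ.near_id (i * η) s hiη hs1 (hst.trans ht) (by linarith)).1 x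
    have m1 : (m * η) ^ a ≤ (t - s + η) ^ a :=
      Real.rpow_le_rpow hmη (by linarith) (by linarith)
    have m2 : (t - i * η) ^ a ≤ (t - s + η) ^ a :=
      Real.rpow_le_rpow (by linarith) (by linarith) (by linarith)
    have m3 : (t - (i + m : ℕ) * η) ^ α ≤ η ^ α :=
      Real.rpow_le_rpow (by linarith) (by linarith) hα.le
    have m4 : (s - i * η) ^ α ≤ η ^ α :=
      Real.rpow_le_rpow (by linarith) (by linarith) hα.le
    rw [hflow]
    set P := gridProd μ η i m x
    set Q := μ ((i + m : ℕ) * η) (i * η) x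
    set R := μ t ((i + m : ℕ) * η) Q
    set S := μ t (i * η) x
    set U := μ t s (μ s (i * η) x)
    have hsum : ‖P - μ t s x‖ ≤ ‖P - Q‖ + ‖R - Q‖ + ‖R - S‖ + ‖U - S‖ + ‖U - μ t s x‖ := by
      have : P - μ t s x = (P - Q) + -(R - Q) + (R - S) + -(U - S) + (U - μ t s x) := by abel
      rw [this]
      refine (norm_add_le _ _).trans (add_le_add ?_ le_rfl)
      refine (norm_add_le _ _).trans (add_le_add ?_ (norm_neg _).le)
      refine (norm_add_le _ _).trans (add_le_add ?_ le_rfl)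
      exact (norm_add_le _ _).trans (add_le_add le_rfl (norm_neg _).le)
    have n1 : L * (m * η) ^ a ≤ L * (t - s + η) ^ a := mul_le_mul_of_nonneg_left m1 hL
    have n2 : C * (t - i * η) ^ a ≤ C * (t - s + η) ^ a := mul_le_mul_of_nonneg_left m2 hC
    have n3 : C * (t - (i + m : ℕ) * η) ^ α ≤ C * η ^ α := mul_le_mul_of_nonneg_left m3 hC
    have n4 : C * (s - i * η) ^ α ≤ C * η ^ α := mul_le_mul_of_nonneg_left m4 hC
    have z1 : 0 ≤ (t - s + η) ^ a := by positivity
    have z2 : 0 ≤ η ^ α := by positivity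
    have z3 : 0 ≤ C * (t - s + η) ^ a := by positivity
    have z4 : 0 ≤ C * η ^ α := by positivity
    have z5 : 0 ≤ C * δ * (t - s + η) ^ a := by positivity
    have z6 : 0 ≤ C * δ * η ^ α := by positivity
    have z7 : 0 ≤ L * η ^ α := by positivity
    linarith

end IsAlmostFlow

lemma tendsto_apply_of_lipschitz {f : ℕ → E → E} {y : ℕ → E} {l l' : E} {K : ℝ} {N : ℕ}
    (hf : ∀ n, N ≤ n → ∀ x y, ‖f n x - f n y‖ ≤ K * ‖x - y‖)
    (hy : Filter.Tendsto y Filter.atTop (nhds l))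
    (hl : Filter.Tendsto (fun n => f n l) Filter.atTop (nhds l')) :
    Filter.Tendsto (fun n => f n (y n)) Filter.atTop (nhds l') := by
  have h1 : Filter.Tendsto (fun n => K * ‖y n - l‖) Filter.atTop (nhds 0) := by
    simpa using (tendsto_iff_norm_sub_tendsto_zero.1 hy).const_mul K
  have h2 : Filter.Tendsto (fun n => f n (y n) - f n l) Filter.atTop (nhds 0) :=
    squeeze_zero_norm' (Filter.eventually_atTop.2 ⟨N, fun n hn => hf n hn _ _⟩) h1
  simpa using h2.add hl

/-- A perturbation of the identity by a contraction is a bi-Lipschitz bijection. -/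
lemma bijective_of_sub_id_contracting {f : E → E}
    (h : ∀ x y, ‖f x - x - (f y - y)‖ ≤ 1 / 2 * ‖x - y‖) :
    Function.Bijective f ∧ (∀ x y, ‖f x - f y‖ ≤ 2 * ‖x - y‖) ∧
      ∀ x y, ‖x - y‖ ≤ 2 * ‖f x - f y‖ := by
  have hco : ∀ x y, ‖x - y‖ ≤ 2 * ‖f x - f y‖ := fun x y => by
    have e : x - y = (f x - f y) - (f x - x - (f y - y)) := by abel
    have h1 : ‖x - y‖ ≤ ‖f x - f y‖ + ‖f x - x - (f y - y)‖ := by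
      conv_lhs => rw [e]
      exact _root_.norm_sub_le _ _
    linarith [h x y]
  refine ⟨⟨fun x y hxy => ?_, fun z => ?_⟩, fun x y => ?_, hco⟩
  · have := hco x y
    rw [hxy, sub_self, norm_zero, mul_zero] at this
    exact sub_eq_zero.1 (norm_le_zero_iff.1 this)
  · have hc : ContractingWith (1 / 2) (fun x => z - (f x - x)) := by
      refine ⟨by rw [← NNReal.coe_lt_coe]; norm_num, LipschitzWith.of_dist_le_mul fun x y => ?_⟩
      rw [dist_eq_norm, dist_eq_norm, sub_sub_sub_cancel_left, norm_sub_rev]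
      simpa using h x y
    have hx := hc.fixedPoint_isFixedPt
    refine ⟨hc.fixedPoint, ?_⟩
    have hx' : z - (f hc.fixedPoint - hc.fixedPoint) = hc.fixedPoint := hx
    rw [sub_sub_eq_add_sub, sub_eq_iff_eq_add] at hx'
    rw [add_comm] at hx'
    exact (add_left_cancel hx').symm
  · have e : f x - f y = (f x - x - (f y - y)) + (x - y) := by abel
    rw [e]
    refine (norm_add_le _ _).trans ?_
    linarith [h x y, norm_nonneg (x - y)]

/-- Every almost flow is close to a genuine flow of uniformly bi-Lipschitz bijections. -/
lemma IsAlmostFlow.exists_flow {T δ₀ C α a : ℝ} {μ : ℝ → ℝ → E → E}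
    (hμ : IsAlmostFlow T δ₀ C α a μ) :
    ∃ φ : ℝ → ℝ → E → E, IsFlowOn T φ ∧
      (∃ δ > (0 : ℝ), ∃ c > (0 : ℝ), ∀ s t : ℝ, 0 ≤ s → s ≤ t → t ≤ T → t - s ≤ δ →
        ∀ x, ‖φ t s x - μ t s x‖ ≤ c * (t - s) ^ a) ∧
      ∃ Λ : ℝ, 0 < Λ ∧ ∀ s t : ℝ, 0 ≤ s → s ≤ t → t ≤ T →
        Function.Bijective (φ t s) ∧ (∀ x y, ‖φ t s x - φ t s y‖ ≤ Λ * ‖x - y‖) ∧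
          (∀ x y, ‖x - y‖ ≤ Λ * ‖φ t s x - φ t s y‖) := by
  obtain ⟨c, δ, r, N, hc, hδ, -, hr0, hr1, hgrid⟩ := hμ.exists_gridFlow_bound
  have hlim : ∀ k : ℕ, ∀ s t : ℝ, 0 ≤ s → s ≤ t → t ≤ T → t - s ≤ k * δ →
      (∀ n, N ≤ n → ∀ x y,
        ‖gridFlow μ n t s x - gridFlow μ n t s y‖ ≤ 2 ^ k * ‖x - y‖) ∧
      ∀ x, ∃ l, Filter.Tendsto (fun n => gridFlow μ n t s x) Filter.atTop (nhds l) := by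
    intro k
    induction k with
    | zero =>
      intro s t _ hst _ hts
      obtain rfl : s = t := by norm_num at hts; linarith
      exact ⟨fun n _ x y => by simp [gridFlow_self], fun x => ⟨x, by simp [gridFlow_self]⟩⟩
    | succ k ih =>
      intro s t hs hst ht hts
      push_cast at hts
      obtain ⟨u, hsu, hut, hus, htu⟩ : ∃ u, s ≤ u ∧ u ≤ t ∧ u - s ≤ k * δ ∧ t - u ≤ δ := by
        refine ⟨max s (t - δ), le_max_left _ _, max_le hst (by linarith), ?_, ?_⟩
        · have : 0 ≤ k * δ := by positivity
          rcases max_choice s (t - δ) with h | h <;> rw [h] <;> linarith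
        · linarith [le_max_right s (t - δ)]
      obtain ⟨ih1, ih2⟩ := ih s u hs hsu (hut.trans ht) hus
      have hg := hgrid u t (hs.trans hsu) hut ht htu
      have hl : ∀ n, N ≤ n → ∀ x y,
          ‖gridFlow μ n t u x - gridFlow μ n t u y‖ ≤ 2 * ‖x - y‖ := fun n hn =>
        (bijective_of_sub_id_contracting (hg n hn).1).2.1
      refine ⟨fun n hn x y => ?_, fun x => ?_⟩
      · rw [gridFlow_comp μ n hsu hut, gridFlow_comp μ n hsu hut, pow_succ]
        have h1 := hl n hn (gridFlow μ n u s x) (gridFlow μ n u s y)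
        have h2 := ih1 n hn x y
        linarith
      · obtain ⟨l, hl'⟩ := ih2 x
        have hcau : CauchySeq (fun n => gridFlow μ (n + N) t u l) := by
          refine cauchySeq_of_le_geometric r (c * r ^ N) hr1 fun n => ?_
          rw [dist_eq_norm, mul_assoc, ← pow_add, add_comm N n]
          have := (hg (n + N) (by omega)).2.1 l
          rwa [show n + N + 1 = n + 1 + N by ring] at this
        obtain ⟨l', h'⟩ := cauchySeq_tendsto_of_complete hcau
        refine ⟨l', ?_⟩
        simp only [gridFlow_comp μ _ hsu hut]
        exact tendsto_apply_of_lipschitz hl hl' ((Filter.tendsto_add_atTop_iff_nat N).1 h')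
  obtain ⟨M, hM⟩ := exists_nat_ge (T / δ)
  rw [div_le_iff₀ hδ] at hM
  have hex : ∀ t s x, ∃ l, 0 ≤ s → s ≤ t → t ≤ T →
      Filter.Tendsto (fun n => gridFlow μ n t s x) Filter.atTop (nhds l) := by
    intro t s x
    by_cases h : 0 ≤ s ∧ s ≤ t ∧ t ≤ T
    · obtain ⟨l, hl⟩ := (hlim M s t h.1 h.2.1 h.2.2 (by linarith [h.1, h.2.2])).2 x
      exact ⟨l, fun _ _ _ => hl⟩
    · exact ⟨0, fun h1 h2 h3 => absurd ⟨h1, h2, h3⟩ h⟩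
  choose φ hφ using hex
  have hflow : IsFlowOn T φ := by
    refine ⟨fun t h0 hT x => ?_, fun s u t hs hsu hut ht x => ?_⟩
    · refine tendsto_nhds_unique (hφ t t x h0 le_rfl hT) ?_
      simp [gridFlow_self]
    · refine tendsto_nhds_unique (hφ t s x hs (hsu.trans hut) ht) ?_
      simp only [gridFlow_comp μ _ hsu hut]
      exact tendsto_apply_of_lipschitz
        (hlim M u t (hs.trans hsu) hut ht (by linarith)).1
        (hφ u s x hs hsu (hut.trans ht)) (hφ t u _ (hs.trans hsu) hut ht)
  refine ⟨φ, hflow, ⟨δ, hδ, c, hc, fun s t hs hst ht hts x => ?_⟩, 2 ^ M, by positivity, ?_⟩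
  · have h1 := ((hφ t s x hs hst ht).sub_const (μ t s x)).norm
    have h0 : Filter.Tendsto (fun n : ℕ => ((1 : ℝ) / 2) ^ n) Filter.atTop (nhds 0) :=
      tendsto_pow_atTop_nhds_zero_of_lt_one (by norm_num) (by norm_num)
    have h2 : Filter.Tendsto (fun n : ℕ => c * (t - s + (1 / 2) ^ n) ^ a + c * ((1 / 2) ^ n) ^ α)
        Filter.atTop (nhds (c * (t - s + 0) ^ a + c * 0 ^ α)) :=
      (((h0.const_add (t - s)).rpow_const (Or.inr (by linarith [hμ.one_lt_a]))).const_mul c).add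
        ((h0.rpow_const (Or.inr hμ.pos_α.le)).const_mul c)
    rw [Real.zero_rpow hμ.pos_α.ne', mul_zero, add_zero, add_zero] at h2
    exact le_of_tendsto_of_tendsto h1 h2
      (Filter.eventually_atTop.2 ⟨N, fun n hn => (hgrid s t hs hst ht hts n hn).2.2 x⟩)
  · have hbi : ∀ k : ℕ, ∀ s t : ℝ, 0 ≤ s → s ≤ t → t ≤ T → t - s ≤ k * δ →
        Function.Bijective (φ t s) ∧ (∀ x y, ‖φ t s x - φ t s y‖ ≤ 2 ^ k * ‖x - y‖) ∧
          (∀ x y, ‖x - y‖ ≤ 2 ^ k * ‖φ t s x - φ t s y‖) := by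
      intro k
      induction k with
      | zero =>
        intro s t hs hst ht hts
        obtain rfl : s = t := by norm_num at hts; linarith
        have e : φ s s = id := funext fun x => hflow.1 s hs ht x
        rw [e]
        exact ⟨Function.bijective_id, fun x y => by simp, fun x y => by simp⟩
      | succ k ih =>
        intro s t hs hst ht hts
        push_cast at hts
        obtain ⟨u, hsu, hut, hus, htu⟩ : ∃ u, s ≤ u ∧ u ≤ t ∧ u - s ≤ k * δ ∧ t - u ≤ δ := by
          refine ⟨max s (t - δ), le_max_left _ _, max_le hst (by linarith), ?_, ?_⟩
          · have : 0 ≤ k * δ := by positivity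
            rcases max_choice s (t - δ) with h | h <;> rw [h] <;> linarith
          · linarith [le_max_right s (t - δ)]
        obtain ⟨b1, l1, c1⟩ := ih s u hs hsu (hut.trans ht) hus
        have hu := hs.trans hsu
        obtain ⟨b2, l2, c2⟩ := bijective_of_sub_id_contracting (f := φ t u) fun x y => by
          have h1 := (((hφ t u x hu hut ht).sub_const x).sub
            ((hφ t u y hu hut ht).sub_const y)).norm
          exact le_of_tendsto h1
            (Filter.eventually_atTop.2 ⟨N, fun n hn => (hgrid u t hu hut ht htu n hn).1 x y⟩)
        have e : φ t s = φ t u ∘ φ u s := funext fun x => hflow.2 s u t hs hsu hut ht x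
        rw [e]
        refine ⟨b2.comp b1, fun x y => ?_, fun x y => ?_⟩
        · rw [pow_succ]
          have h1 := l2 (φ u s x) (φ u s y)
          have h2 := l1 x y
          simp only [Function.comp_apply]
          linarith
        · rw [pow_succ, mul_assoc]
          exact (c1 x y).trans (mul_le_mul_of_nonneg_left (c2 _ _) (by positivity))
    intro s t hs hst ht
    exact hbi M s t hs hst ht (by linarith)

/-- Two flows that are infinitesimally close, one of which is uniformly Lipschitz, coincide. -/
lemma IsFlowOn.eq_of_close {T a δ c Λ : ℝ} {φ ψ : ℝ → ℝ → E → E} (hφ : IsFlowOn T φ)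
    (hψ : IsFlowOn T ψ) (ha : 1 < a) (hδ : 0 < δ) (hΛ : 0 ≤ Λ)
    (hlip : ∀ s t, 0 ≤ s → s ≤ t → t ≤ T → ∀ x y, ‖φ t s x - φ t s y‖ ≤ Λ * ‖x - y‖)
    (hclose : ∀ s t, 0 ≤ s → s ≤ t → t ≤ T → t - s ≤ δ → ∀ x,
      ‖ψ t s x - φ t s x‖ ≤ c * (t - s) ^ a)
    {s t : ℝ} (hs : 0 ≤ s) (hst : s ≤ t) (ht : t ≤ T) (x : E) : ψ t s x = φ t s x := by
  have key : ∀ N : ℕ, 0 < N → (t - s) / N ≤ δ →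
      ‖ψ t s x - φ t s x‖ ≤ N * (Λ * (c * ((t - s) / N) ^ a)) := by
    intro N hN hNδ
    have hN' : (0 : ℝ) < N := by exact_mod_cast hN
    set η := (t - s) / N with hη
    have hη0 : 0 ≤ η := div_nonneg (by linarith) hN'.le
    have hNη : N * η = t - s := by rw [hη]; field_simp
    have step : ∀ k : ℕ, k ≤ N →
        ‖φ t (s + k * η) (ψ (s + k * η) s x) - φ t s x‖ ≤ k * (Λ * (c * η ^ a)) := by
      intro k
      induction k with
      | zero =>
        intro _
        simp [hψ.1 s hs (hst.trans ht) x]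
      | succ k ih =>
        intro hk
        have hkN : ((k + 1 : ℕ) : ℝ) ≤ N := by exact_mod_cast hk
        have hle : s + ((k + 1 : ℕ) : ℝ) * η ≤ t := by
          have := mul_le_mul_of_nonneg_right hkN hη0
          linarith
        have hk0 : 0 ≤ (k : ℝ) * η := by positivity
        push_cast at hle ⊢
        set u := s + (k : ℝ) * η with hu
        set v := s + ((k : ℝ) + 1) * η with hv
        have huv : v - u = η := by rw [hu, hv]; ring
        have hsu : s ≤ u := by linarith
        have huv' : u ≤ v := by linarith
        have hvT : v ≤ T := hle.trans ht
        have h1 := ih (by omega)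
        have h2 := hclose u v (hs.trans hsu) huv' hvT (by rw [huv]; exact hNδ) (ψ u s x)
        rw [huv] at h2
        have h3 := hlip v t (hs.trans (hsu.trans huv')) hle ht
          (ψ v u (ψ u s x)) (φ v u (ψ u s x))
        rw [hψ.2 s u v hs hsu huv' hvT x]
        rw [hφ.2 u v t (hs.trans hsu) huv' hle ht] at h1
        refine (norm_sub_le_norm_sub_add_norm_sub _ _ _).trans
          ((add_le_add (h3.trans (mul_le_mul_of_nonneg_left h2 hΛ)) h1).trans ?_)
        linarith
    have := step N le_rfl
    rwa [hNη, add_sub_cancel, hφ.1 t (hs.trans hst) ht] at this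
  have hlim : Filter.Tendsto
      (fun N : ℕ => Λ * c * (t - s) ^ a * ((N : ℝ) ^ (-(a - 1)))) Filter.atTop (nhds 0) := by
    simpa using ((tendsto_rpow_neg_atTop (by linarith : 0 < a - 1)).comp
      tendsto_natCast_atTop_atTop).const_mul (Λ * c * (t - s) ^ a)
  obtain ⟨N₀, hN₀⟩ := exists_nat_ge ((t - s) / δ)
  rw [div_le_iff₀ hδ] at hN₀
  have hle : ‖ψ t s x - φ t s x‖ ≤ 0 := by
    refine ge_of_tendsto hlim (Filter.eventually_atTop.2 ⟨N₀ + 1, fun N hN => ?_⟩)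
    have hN0 : 0 < N := by omega
    have hN' : (0 : ℝ) < N := by exact_mod_cast hN0
    have hNN : (N₀ : ℝ) ≤ N := by exact_mod_cast (by omega : N₀ ≤ N)
    have hk := key N hN0 (by
      rw [div_le_iff₀ hN', mul_comm]
      exact hN₀.trans (mul_le_mul_of_nonneg_right hNN hδ.le))
    refine hk.trans (le_of_eq ?_)
    have h1 : (N : ℝ) ^ (-(a - 1)) = N / (N : ℝ) ^ a := by
      rw [neg_sub, Real.rpow_sub hN', Real.rpow_one]
    rw [h1, Real.div_rpow (by linarith) hN'.le]
    ring
  exact sub_eq_zero.1 (norm_le_zero_iff.1 hle)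


/-! ### The time-one maps of the driven equation form an almost flow -/

/-- The vector field `∑ i, a i • Vf i`. -/
def linComb {ℓ : ℕ} (Vf : Fin ℓ → E → E) (a : EuclideanSpace ℝ (Fin ℓ)) : E → E :=
  fun y => ∑ i, a i • Vf i y

/-- The part of `rdeDriver` without the first-order term `linComb`. -/
def secondOrderDriver {ℓ : ℕ} (V : E → E) (Vf : Fin ℓ → E → E)
    (b : EuclideanSpace ℝ (Fin ℓ × Fin ℓ)) (τ : ℝ) : E → E :=
  fun y => τ • V y + (2⁻¹ : ℝ) • ∑ j, ∑ k, b (j, k) • bracket (Vf j) (Vf k) y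

lemma rdeDriver_eq_add {ℓ : ℕ} (V : E → E) (Vf : Fin ℓ → E → E) (a : EuclideanSpace ℝ (Fin ℓ))
    (b : EuclideanSpace ℝ (Fin ℓ × Fin ℓ)) (τ : ℝ) (x : E) :
    rdeDriver ℓ V Vf a b τ x = linComb Vf a x + secondOrderDriver V Vf b τ x := by
  simp only [rdeDriver, linComb, secondOrderDriver]
  abel

lemma derivAlong_linComb {ℓ : ℕ} {Vf : Fin ℓ → E → E} (hVf : ∀ i, Differentiable ℝ (Vf i))
    (a b : EuclideanSpace ℝ (Fin ℓ)) (x : E) :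
    derivAlong (linComb Vf b) (linComb Vf a) x =
      ∑ j, ∑ k, (a j * b k) • derivAlong (Vf k) (Vf j) x := by
  have h : HasFDerivAt (linComb Vf b) (∑ k, b k • fderiv ℝ (Vf k) x) x :=
    HasFDerivAt.fun_sum fun k _ => ((hVf k x).hasFDerivAt).fun_const_smul (b k)
  simp only [derivAlong, h.fderiv, linComb, map_sum, map_smul, sum_apply,
    smul_apply, Finset.smul_sum, smul_smul]

lemma derivAlong_linComb_add {ℓ : ℕ} {Vf : Fin ℓ → E → E} (hVf : ∀ i, Differentiable ℝ (Vf i))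
    (a b a' b' : EuclideanSpace ℝ (Fin ℓ)) (x : E) :
    derivAlong (linComb Vf (b + b')) (linComb Vf (a + a')) x =
      derivAlong (linComb Vf b) (linComb Vf a) x + derivAlong (linComb Vf b') (linComb Vf a) x +
      (derivAlong (linComb Vf b) (linComb Vf a') x +
        derivAlong (linComb Vf b') (linComb Vf a') x) := by
  simp only [derivAlong_linComb hVf, ← Finset.sum_add_distrib, ← add_smul, PiLp.add_apply]
  refine Finset.sum_congr rfl fun j _ => Finset.sum_congr rfl fun k _ => ?_
  congr 1
  ring

lemma rdeDriver_chen {ℓ : ℕ} {V : E → E} {Vf : Fin ℓ → E → E}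
    (hVf : ∀ i, Differentiable ℝ (Vf i)) {a a' a'' : EuclideanSpace ℝ (Fin ℓ)}
    {b b' b'' : EuclideanSpace ℝ (Fin ℓ × Fin ℓ)} {τ τ' τ'' : ℝ} (hτ : τ'' = τ' + τ)
    (ha : a'' = a' + a) (hb : ∀ q, b'' q = b' q + b q + a q.1 * a' q.2) (x : E) :
    rdeDriver ℓ V Vf a'' b'' τ'' x +
        (2⁻¹ : ℝ) • derivAlong (linComb Vf a'') (linComb Vf a'') x =
      (rdeDriver ℓ V Vf a b τ x + (2⁻¹ : ℝ) • derivAlong (linComb Vf a) (linComb Vf a) x) +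
      (rdeDriver ℓ V Vf a' b' τ' x + (2⁻¹ : ℝ) • derivAlong (linComb Vf a') (linComb Vf a') x) +
      derivAlong (linComb Vf a') (linComb Vf a) x := by
  have h1 : ∑ j, ∑ k, b'' (j, k) • bracket (Vf j) (Vf k) x =
      ∑ j, ∑ k, b' (j, k) • bracket (Vf j) (Vf k) x +
      ∑ j, ∑ k, b (j, k) • bracket (Vf j) (Vf k) x +
      (derivAlong (linComb Vf a') (linComb Vf a) x -
        derivAlong (linComb Vf a) (linComb Vf a') x) := by
    rw [derivAlong_linComb hVf, derivAlong_linComb hVf a' a, Finset.sum_comm (f := fun j k =>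
      (a' j * a k) • derivAlong (Vf k) (Vf j) x)]
    simp only [← Finset.sum_add_distrib, ← Finset.sum_sub_distrib]
    refine Finset.sum_congr rfl fun j _ => Finset.sum_congr rfl fun k _ => ?_
    simp only [hb, bracket, derivAlong]
    module
  have h2 : linComb Vf (a' + a) x = linComb Vf a' x + linComb Vf a x := by
    simp only [linComb, ← Finset.sum_add_distrib, ← add_smul, PiLp.add_apply]
  subst ha hτ
  simp only [rdeDriver_eq_add, secondOrderDriver, h1, h2, derivAlong_linComb_add hVf]
  module

lemma exists_isGradedField_rdeDriver {ℓ : ℕ} {V : E → E} {Vf : Fin ℓ → E → E} (hV : CkbMap 2 V)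
    (hVf : ∀ i, CkbMap 3 (Vf i)) (K : ℝ) :
    ∃ A, ∀ (a : EuclideanSpace ℝ (Fin ℓ)) (b : EuclideanSpace ℝ (Fin ℓ × Fin ℓ)) (τ h : ℝ),
      0 ≤ h → h ≤ 1 → ‖a‖ ≤ K * h → ‖b‖ ≤ K * h ^ 2 → |τ| ≤ h ^ 2 →
      IsGradedField A h (linComb Vf a) (secondOrderDriver V Vf b τ) (rdeDriver ℓ V Vf a b τ) := by
  obtain ⟨M, hM, hVM⟩ := hV.exists_ckBound
  choose N hN hVN using fun i => (hVf i).exists_ckBound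
  have hbr : ∀ j k, CkBound 2 (2 ^ 2 * (N k * N j) + 2 ^ 2 * (N j * N k))
      (bracket (Vf j) (Vf k)) := fun j k => by
    have h := ((hVN k).derivAlong (k := 2) (hN k) ((hVN j).mono (by omega) le_rfl)).add
      (((hVN j).derivAlong (k := 2) (hN j) ((hVN k).mono (by omega) le_rfl)).const_smul (-1))
    have e : bracket (Vf j) (Vf k) =
        fun x => derivAlong (Vf k) (Vf j) x + (-1 : ℝ) • derivAlong (Vf j) (Vf k) x := by
      funext x
      simp [bracket, derivAlong, sub_eq_add_neg]
    rw [e]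
    exact h.mono le_rfl (by simp)
  set A₁ := ∑ i, |K| * N i with hA₁
  set A₂ := M + |(2⁻¹ : ℝ)| *
    ∑ j, ∑ k, |K| * (2 ^ 2 * (N k * N j) + 2 ^ 2 * (N j * N k)) with hA₂
  have h0 : ∀ j k, 0 ≤ 2 ^ 2 * (N k * N j) + 2 ^ 2 * (N j * N k) := fun j k => by
    have := mul_nonneg (hN j) (hN k)
    nlinarith
  have h1 : 0 ≤ A₁ := Finset.sum_nonneg fun i _ => mul_nonneg (abs_nonneg _) (hN i)
  have h2 : 0 ≤ A₂ := add_nonneg hM (mul_nonneg (abs_nonneg _) (Finset.sum_nonneg fun j _ =>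
    Finset.sum_nonneg fun k _ => mul_nonneg (abs_nonneg _) (h0 j k)))
  refine ⟨A₁ + A₂, fun a b τ h hh hh1 ha hb hτ => ⟨add_nonneg h1 h2, hh, hh1, ?_, ?_,
    rdeDriver_eq_add V Vf a b τ⟩⟩
  · refine (CkBound.sum Finset.univ fun i _ => (hVN i).const_smul (a i)).mono le_rfl ?_
    calc ∑ i, |a i| * N i ≤ ∑ i, |K| * N i * h := Finset.sum_le_sum fun i _ => by
          have : |a i| ≤ |K| * h := (PiLp.norm_apply_le a i).trans
            (ha.trans (mul_le_mul_of_nonneg_right (le_abs_self K) hh))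
          nlinarith [hN i]
      _ = A₁ * h := by rw [hA₁, Finset.sum_mul]
      _ ≤ (A₁ + A₂) * h := by nlinarith
  · refine ((hVM.const_smul τ).add ((CkBound.sum Finset.univ fun j _ => CkBound.sum Finset.univ
      fun k _ => (hbr j k).const_smul (b (j, k))).const_smul 2⁻¹)).mono le_rfl ?_
    calc _ ≤ h ^ 2 * M + |(2⁻¹ : ℝ)| * ∑ j, ∑ k,
            |K| * (2 ^ 2 * (N k * N j) + 2 ^ 2 * (N j * N k)) * h ^ 2 := by
          refine add_le_add (mul_le_mul_of_nonneg_right hτ hM) (mul_le_mul_of_nonneg_left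
            (Finset.sum_le_sum fun j _ => Finset.sum_le_sum fun k _ => ?_) (abs_nonneg _))
          have : |b (j, k)| ≤ |K| * h ^ 2 := (PiLp.norm_apply_le b (j, k)).trans
            (hb.trans (mul_le_mul_of_nonneg_right (le_abs_self K) (by positivity)))
          nlinarith [h0 j k]
      _ = A₂ * h ^ 2 := by simp only [hA₂, ← Finset.sum_mul]; ring
      _ ≤ (A₁ + A₂) * h ^ 2 := by nlinarith [sq_nonneg h]

/-- The time-one maps of `rdeDriver` along a rough path form an almost flow. -/
lemma exists_isAlmostFlow {ℓ : ℕ} {T p : ℝ} (hp1 : 2 ≤ p) (hp2 : p < 3)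
    {V : E → E} {Vf : Fin ℓ → E → E} (hV : CkbMap 2 V) (hVf : ∀ i, CkbMap 3 (Vf i))
    {X : ℝ → ℝ → EuclideanSpace ℝ (Fin ℓ)} {XX : ℝ → ℝ → EuclideanSpace ℝ (Fin ℓ × Fin ℓ)}
    (hChen : ∀ s u t : ℝ, 0 ≤ s → s ≤ u → u ≤ t → t ≤ T →
      X t s = X t u + X u s ∧
      ∀ q : Fin ℓ × Fin ℓ, XX t s q = XX t u q + XX u s q + X u s q.1 * X t u q.2)
    {K : ℝ} (hhol : ∀ s t : ℝ, 0 ≤ s → s ≤ t → t ≤ T →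
      ‖X t s‖ ≤ K * (t - s) ^ (1 / p) ∧ ‖XX t s‖ ≤ K * (t - s) ^ (2 / p))
    {μ : ℝ → ℝ → E → E}
    (hμ : ∀ s t : ℝ, 0 ≤ s → s ≤ t → t ≤ T → ∀ x : E, ∃ y : ℝ → E,
      y 0 = x ∧ y 1 = μ t s x ∧ ∀ u ∈ Set.Icc (0:ℝ) 1,
        HasDerivAt y (rdeDriver ℓ V Vf (X t s) (XX t s) (t - s) (y u)) u) :
    ∃ C, IsAlmostFlow T 1 C (1 / p) (3 / p) μ := by
  have hp : 0 < p := by linarith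
  obtain ⟨A, hA⟩ := exists_isGradedField_rdeDriver hV hVf |K|
  have hA0 : 0 ≤ A := (hA 0 0 0 0 le_rfl zero_le_one (by simp) (by simp) (by simp)).nonneg_A
  have hsol : ∀ s t : ℝ, 0 ≤ s → s ≤ t → t ≤ T → ∃ Y : ℝ → E → E,
      IsSolutionMap (rdeDriver ℓ V Vf (X t s) (XX t s) (t - s)) Y ∧ ∀ x, Y 1 x = μ t s x := by
    intro s t hs hst ht
    choose y h0 h1 h2 using hμ s t hs hst ht
    exact ⟨fun u x => y x u, ⟨h0, h2⟩, h1⟩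
  have hpow : ∀ τ : ℝ, 0 ≤ τ → ∀ n : ℕ, (τ ^ (1 / p)) ^ n = τ ^ ((n : ℝ) / p) := fun τ hτ n => by
    rw [← Real.rpow_natCast, ← Real.rpow_mul hτ]
    congr 1
    ring
  have hgr : ∀ s t h : ℝ, 0 ≤ s → s ≤ t → t ≤ T → t - s ≤ 1 → (t - s) ^ (1 / p) ≤ h → h ≤ 1 →
      IsGradedField A h (linComb Vf (X t s)) (secondOrderDriver V Vf (XX t s) (t - s))
        (rdeDriver ℓ V Vf (X t s) (XX t s) (t - s)) := by
    intro s t h hs hst ht hts hh hh1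
    have hτ : 0 ≤ t - s := sub_nonneg.2 hst
    have hh0 : 0 ≤ (t - s) ^ (1 / p) := Real.rpow_nonneg hτ _
    have hh2 : (t - s) ^ (2 / p) ≤ h ^ 2 := by
      have := hpow _ hτ 2
      push_cast at this
      rw [← this]
      gcongr
    obtain ⟨h1, h2⟩ := hhol s t hs hst ht
    refine hA _ _ _ _ (hh0.trans hh) hh1
      (h1.trans (mul_le_mul (le_abs_self K) hh hh0 (abs_nonneg K)))
      (h2.trans (mul_le_mul (le_abs_self K) hh2 (Real.rpow_nonneg hτ _) (abs_nonneg K))) ?_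
    rw [abs_of_nonneg hτ]
    rcases hτ.eq_or_lt with h0 | h0
    · rw [← h0]
      positivity
    · calc t - s = (t - s) ^ (1 : ℝ) := (Real.rpow_one _).symm
        _ ≤ (t - s) ^ (2 / p) :=
          Real.rpow_le_rpow_of_exponent_ge h0 hts ((div_le_one hp).2 hp1)
        _ ≤ h ^ 2 := hh2
  have hle1 : ∀ τ : ℝ, 0 ≤ τ → τ ≤ 1 → τ ^ (1 / p) ≤ 1 := fun τ h0 h1 =>
    Real.rpow_le_one h0 h1 (by positivity)
  set C₁ := 2 * A * Real.exp (2 * A)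
  set C₂ := 2 * A * (2 * Real.exp (2 * A + 1) ^ 3)
  set C₃ := expansionConst A * (Real.exp (2 * A) + 4) with hC₃
  have hC1 : 0 ≤ C₁ := by positivity
  have hC2 : 0 ≤ C₂ := by positivity
  have hC3 : 0 ≤ C₃ := by
    rw [hC₃, expansionConst]
    positivity
  refine ⟨C₁ + C₂ + C₃, one_pos, by positivity, by positivity, (one_lt_div hp).2 hp2,
    fun s t hs hst ht hts => ?_, fun s t hs hst ht hts x y z w => ?_,
    fun s u t hs hsu hut ht hts => ?_⟩
  · have hτ : 0 ≤ t - s := sub_nonneg.2 hst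
    have hg := hgr s t _ hs hst ht hts le_rfl (hle1 _ hτ hts)
    obtain ⟨Y, hY, hY1⟩ := hsol s t hs hst ht
    have := hY.boundedLipschitz_sub_id (hg.ckBound.mono (by omega) le_rfl).boundedLipschitz
    simp only [hY1] at this
    refine this.mono ?_
    have hh := hg.nonneg_h
    calc _ ≤ 2 * A * (t - s) ^ (1 / p) * Real.exp (2 * A) :=
          mul_le_mul_of_nonneg_left hg.exp_le (by positivity)
      _ = C₁ * (t - s) ^ (1 / p) := by ring
      _ ≤ _ := mul_le_mul_of_nonneg_right (by linarith) hh
  · have hτ : 0 ≤ t - s := sub_nonneg.2 hst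
    have hg := hgr s t _ hs hst ht hts le_rfl (hle1 _ hτ hts)
    obtain ⟨Y, hY, hY1⟩ := hsol s t hs hst ht
    have hh := hg.nonneg_h
    have := hY.norm_four_point_le hg.ckBound (B₀ := 2 * A + 1) (by positivity)
      (by nlinarith [hg.h_le_one]) x y z w
    simp only [hY1] at this
    refine this.trans (mul_le_mul_of_nonneg_right ?_ (by positivity))
    calc _ = C₂ * (t - s) ^ (1 / p) := by ring
      _ ≤ _ := mul_le_mul_of_nonneg_right (by linarith) hh
  · have hst := hsu.trans hut
    have hτ : 0 ≤ t - s := sub_nonneg.2 hst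
    have hp' : 0 ≤ 1 / p := by positivity
    have hl := hle1 _ hτ hts
    have hg := hgr s u _ hs hsu (hut.trans ht) (by linarith)
      (Real.rpow_le_rpow (sub_nonneg.2 hsu) (by linarith) hp') hl
    have hg' := hgr u t _ (hs.trans hsu) hut ht (by linarith)
      (Real.rpow_le_rpow (sub_nonneg.2 hut) (by linarith) hp') hl
    have hg'' := hgr s t _ hs hst ht hts le_rfl hl
    obtain ⟨Y, hY, hY1⟩ := hsol s u hs hsu (hut.trans ht)
    obtain ⟨Y', hY', hY1'⟩ := hsol u t (hs.trans hsu) hut ht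
    obtain ⟨Y'', hY'', hY1''⟩ := hsol s t hs hst ht
    obtain ⟨c1, c2⟩ := hChen s u t hs hsu hut ht
    have := hg.boundedLipschitz_comp_sub hg' hg'' hY hY' hY'' (rdeDriver_chen
      (fun i => (hVf i).1.differentiable (by norm_num)) (by ring) c1 c2)
    simp only [hY1, hY1', hY1''] at this
    refine this.mono ?_
    have e := hpow _ hτ 3
    push_cast at e
    rw [e]
    exact mul_le_mul_of_nonneg_right (by linarith) (Real.rpow_nonneg hτ _)

/-- **Well-posedness of the rough differential equation on flows, `2 ≤ p < 3`.**
There is exactly one flow `φ` with `‖φ_{ts} - μ_{ts}‖_∞ ≤ c |t-s|^{3/p}` for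
`t - s ≤ δ`; its maps are homeomorphisms of `E`, Lipschitz with Lipschitz inverses,
uniformly in `(s,t)`. -/
theorem rde_flow_well_posed
    (ℓ : ℕ) (T p : ℝ) (hT : 0 < T) (hp1 : 2 ≤ p) (hp2 : p < 3)
    (V : E → E) (Vf : Fin ℓ → E → E)
    (hV : CkbMap 2 V) (hVf : ∀ i, CkbMap 3 (Vf i))
    (X : ℝ → ℝ → EuclideanSpace ℝ (Fin ℓ))
    (XX : ℝ → ℝ → EuclideanSpace ℝ (Fin ℓ × Fin ℓ))
    (hXcont : ContinuousOn (fun q : ℝ × ℝ => X q.2 q.1)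
      {q : ℝ × ℝ | 0 ≤ q.1 ∧ q.1 ≤ q.2 ∧ q.2 ≤ T})
    (hXXcont : ContinuousOn (fun q : ℝ × ℝ => XX q.2 q.1)
      {q : ℝ × ℝ | 0 ≤ q.1 ∧ q.1 ≤ q.2 ∧ q.2 ≤ T})
    (hChen : ∀ s u t : ℝ, 0 ≤ s → s ≤ u → u ≤ t → t ≤ T →
      X t s = X t u + X u s ∧
      ∀ q : Fin ℓ × Fin ℓ, XX t s q = XX t u q + XX u s q + X u s q.1 * X t u q.2)
    (hgeom : ∀ s t : ℝ, 0 ≤ s → s ≤ t → t ≤ T → ∀ j k : Fin ℓ,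
      XX t s (j, k) + XX t s (k, j) = X t s j * X t s k)
    (hhol : ∃ K : ℝ, ∀ s t : ℝ, 0 ≤ s → s ≤ t → t ≤ T →
      ‖X t s‖ ≤ K * (t - s) ^ (1 / p) ∧ ‖XX t s‖ ≤ K * (t - s) ^ (2 / p))
    (μ : ℝ → ℝ → E → E)
    (hμ : ∀ s t : ℝ, 0 ≤ s → s ≤ t → t ≤ T → ∀ x : E, ∃ y : ℝ → E,
      y 0 = x ∧ y 1 = μ t s x ∧ ∀ u ∈ Set.Icc (0:ℝ) 1,
        HasDerivAt y (rdeDriver ℓ V Vf (X t s) (XX t s) (t - s) (y u)) u) :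
    ∃ φ : ℝ → ℝ → E → E,
      (IsFlowOn T φ ∧ IsApproximatedBy T p μ φ ∧
        ∃ Λ : ℝ, 0 < Λ ∧ ∀ s t : ℝ, 0 ≤ s → s ≤ t → t ≤ T →
          Function.Bijective (φ t s) ∧
          (∀ x y : E, ‖φ t s x - φ t s y‖ ≤ Λ * ‖x - y‖) ∧
          (∀ x y : E, ‖x - y‖ ≤ Λ * ‖φ t s x - φ t s y‖)) ∧
      ∀ ψ : ℝ → ℝ → E → E, IsFlowOn T ψ → IsApproximatedBy T p μ ψ →
        ∀ s t : ℝ, 0 ≤ s → s ≤ t → t ≤ T → ∀ x : E, ψ t s x = φ t s x := by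
  obtain ⟨K, hK⟩ := hhol
  obtain ⟨C, hC⟩ := exists_isAlmostFlow hp1 hp2 hV hVf hChen hK hμ
  obtain ⟨φ, hφ, hφμ, Λ, hΛ, hΛφ⟩ := hC.exists_flow
  refine ⟨φ, ⟨hφ, hφμ, Λ, hΛ, hΛφ⟩, fun ψ hψ hψμ s t hs hst ht x => ?_⟩
  obtain ⟨δ, hδ, c, -, hc⟩ := hφμ
  obtain ⟨δ', hδ', c', -, hc'⟩ := hψμ
  refine hφ.eq_of_close hψ hC.one_lt_a (lt_min hδ hδ') hΛ.le
    (fun s t hs hst ht => (hΛφ s t hs hst ht).2.1) (c := c' + c)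
    (fun s t hs hst ht hts x => ?_) hs hst ht x
  calc ‖ψ t s x - φ t s x‖ = ‖(ψ t s x - μ t s x) - (φ t s x - μ t s x)‖ := by
        rw [sub_sub_sub_cancel_right]
    _ ≤ ‖ψ t s x - μ t s x‖ + ‖φ t s x - μ t s x‖ := norm_sub_le _ _
    _ ≤ c' * (t - s) ^ (3 / p) + c * (t - s) ^ (3 / p) :=
      add_le_add (hc' s t hs hst ht (hts.trans (min_le_right _ _)) x)
        (hc s t hs hst ht (hts.trans (min_le_left _ _)) x)
    _ = (c' + c) * (t - s) ^ (3 / p) := by ring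
end
end
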